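/- arXiv:1009.1939 — 2 statements merged into one kernel-verified Lean document; each statement's English description precedes it below -/
import Mathlib

section
/- In the partition algebra A_k(z) (k ≥ 3): for every i with 2 ≤ i ≤ k−1 one has σ_{i+1} p_{i−1/2} = p_{i−1/2} σ_{i+1} = p_{i−1/2} L_{i−1} s_i p_{i−1/2}. -/
open Polynomial

/-- Elements of an algebra over `R = ℤ[z]` (with `z = Polynomial.X`) satisfying the
defining relations of the partition algebra `A_k(z)` of Halverson–Ram.
Here `p i` stands for the generator `p_i` (for `1 ≤ i ≤ k`), `q i` stands for the
half-integer generator `p_{i+1/2}` (for `1 ≤ i ≤ k-1`), and `s i` stands for `s_i`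
(for `1 ≤ i ≤ k-1`). -/
structure PartitionAlgebra (k : ℕ) (A : Type*) [Ring A] [Algebra (Polynomial ℤ) A] where
  p : ℕ → A
  q : ℕ → A
  s : ℕ → A
  s_sq : ∀ i, 1 ≤ i → i ≤ k - 1 → s i * s i = 1
  s_comm : ∀ i j, 1 ≤ i → i ≤ k - 1 → 1 ≤ j → j ≤ k - 1 → j ≠ i + 1 → i ≠ j + 1 →
    s i * s j = s j * s i
  braid : ∀ i, 1 ≤ i → i + 1 ≤ k - 1 →
    s i * s (i + 1) * s i = s (i + 1) * s i * s (i + 1)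
  p_sq : ∀ i, 1 ≤ i → i ≤ k → p i * p i = (X : Polynomial ℤ) • p i
  q_sq : ∀ i, 1 ≤ i → i ≤ k - 1 → q i * q i = q i
  s_q : ∀ i, 1 ≤ i → i ≤ k - 1 → s i * q i = q i
  q_s : ∀ i, 1 ≤ i → i ≤ k - 1 → q i * s i = q i
  s_pp : ∀ i, 1 ≤ i → i ≤ k - 1 → s i * (p i * p (i + 1)) = p i * p (i + 1)
  pp_s : ∀ i, 1 ≤ i → i ≤ k - 1 → p i * p (i + 1) * s i = p i * p (i + 1)
  p_comm : ∀ i j, 1 ≤ i → i ≤ k → 1 ≤ j → j ≤ k → p i * p j = p j * p i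
  q_comm : ∀ i j, 1 ≤ i → i ≤ k - 1 → 1 ≤ j → j ≤ k - 1 → q i * q j = q j * q i
  q_p : ∀ i j, 1 ≤ i → i ≤ k - 1 → 1 ≤ j → j ≤ k → j ≠ i → j ≠ i + 1 →
    q i * p j = p j * q i
  s_p : ∀ i j, 1 ≤ i → i ≤ k - 1 → 1 ≤ j → j ≤ k → j ≠ i → j ≠ i + 1 →
    s i * p j = p j * s i
  s_q' : ∀ i j, 1 ≤ i → i ≤ k - 1 → 1 ≤ j → j ≤ k - 1 → j + 1 ≠ i → j ≠ i + 1 →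
    s i * q j = q j * s i
  sps : ∀ i, 1 ≤ i → i ≤ k - 1 → s i * p i * s i = p (i + 1)
  sqs : ∀ i, 2 ≤ i → i ≤ k - 1 →
    s i * q (i - 1) * s i = s (i - 1) * q i * s (i - 1)
  qpq₁ : ∀ i, 1 ≤ i → i ≤ k - 1 → q i * p i * q i = q i
  qpq₂ : ∀ i, 1 ≤ i → i ≤ k - 1 → q i * p (i + 1) * q i = q i
  pqp₁ : ∀ i, 2 ≤ i → i ≤ k → p i * q (i - 1) * p i = p i
  pqp₂ : ∀ i, 1 ≤ i → i ≤ k - 1 → p i * q i * p i = p i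

namespace PartitionAlgebra

variable {k : ℕ} {A : Type*} [Ring A] [Algebra (Polynomial ℤ) A]

/-- `(P.LS i).1 = L_i` and `(P.LS i).2 = σ_i` (with the junk value `σ_0 := 1`). -/
def LS (P : PartitionAlgebra k A) : ℕ → A × A
  | 0 => (0, 1)
  | 1 => (P.p 1, 1)
  | n + 2 =>
    let Lp := (P.LS (n + 1)).1
    let sp := (P.LS (n + 1)).2
    let Lpp := (P.LS n).1
    let snew : A :=
      if n = 0 then P.s 1
      else
        P.s n * P.s (n + 1) * sp * P.s (n + 1) * P.s n
          + P.s (n + 1) * P.q n * Lpp * P.s (n + 1) * P.q n * P.s (n + 1)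
          + P.q n * Lpp * P.s (n + 1) * P.q n
          - P.s (n + 1) * P.q n * Lpp * P.s n * P.q (n + 1) * P.p (n + 1) * P.q n
          - P.q n * P.p (n + 1) * P.q (n + 1) * P.s n * Lpp * P.q n * P.s (n + 1)
    (-(P.s (n + 1) * Lp * P.q (n + 1)) - P.q (n + 1) * Lp * P.s (n + 1)
        + P.q (n + 1) * Lp * P.p (n + 2) * P.q (n + 1)
        + P.s (n + 1) * Lp * P.s (n + 1) + snew,
      snew)

/-- The Jucys–Murphy element `L_i` of the partition algebra. -/
def L (P : PartitionAlgebra k A) (i : ℕ) : A := (P.LS i).1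

/-- The element `σ_i` of the partition algebra. -/
def sig (P : PartitionAlgebra k A) (i : ℕ) : A := (P.LS i).2

/-- `(P.LSh i).1 = L_{i+1/2}` and `(P.LSh i).2 = σ_{i+1/2}`. -/
def LSh (P : PartitionAlgebra k A) : ℕ → A × A
  | 0 => (0, 1)
  | 1 =>
    (-(P.L 1 * P.q 1) - P.q 1 * P.L 1 + P.q 1 * P.L 1 * P.p 1 * P.q 1
        + P.s 1 * (0 : A) * P.s 1 + 1, 1)
  | n + 2 =>
    let Lhp := (P.LSh (n + 1)).1
    let shp := (P.LSh (n + 1)).2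
    let snew : A :=
      P.s (n + 1) * P.s (n + 2) * shp * P.s (n + 2) * P.s (n + 1)
        + P.q (n + 1) * P.L (n + 1) * P.s (n + 2) * P.q (n + 1) * P.s (n + 2)
        + P.s (n + 2) * P.q (n + 1) * P.L (n + 1) * P.s (n + 2) * P.q (n + 1)
        - P.q (n + 1) * P.L (n + 1) * P.s (n + 1) * P.q (n + 2) * P.p (n + 2) * P.q (n + 1)
        - P.s (n + 2) * P.q (n + 1) * P.p (n + 2) * P.q (n + 2) * P.s (n + 1)
            * P.L (n + 1) * P.q (n + 1) * P.s (n + 2)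
    (-(P.L (n + 2) * P.q (n + 2)) - P.q (n + 2) * P.L (n + 2)
        + P.q (n + 2) * P.L (n + 2) * P.p (n + 2) * P.q (n + 2)
        + P.s (n + 2) * Lhp * P.s (n + 2) + snew,
      snew)

/-- The half-integer Jucys–Murphy element `L_{i+1/2}` of the partition algebra. -/
def Lh (P : PartitionAlgebra k A) (i : ℕ) : A := (P.LSh i).1

/-- The element `σ_{i+1/2}` of the partition algebra. -/
def sigH (P : PartitionAlgebra k A) (i : ℕ) : A := (P.LSh i).2

end PartitionAlgebra

namespace PartitionAlgebra

/-- Equality of elements of a monoid, tested on a faithful action; this turns identities between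
words into identities between iterated actions, which need no reassociation. -/
theorem eq_iff_option_smul {A : Type*} [Monoid A] (a b : A) :
    a = b ↔ ∀ x : Option A, a • x = b • x :=
  ⟨fun h _ => h ▸ rfl, fun h => by simpa using h (some 1)⟩

/-- Relations between `t = s_n`, `s = s_{n+1}`, `q = p_{n+1/2}`, `w = p_{n+3/2}`, `b = p_n`,
`c = p_{n+1}` and an element `L` commuting with `s` and `w`. -/
structure AdjacentRelations {A : Type*} [Monoid A] (t s q w b c L : A) : Prop where
  t_t : t * t = 1
  s_s : s * s = 1
  t_s_t : t * s * t = s * t * s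
  s_q_s : s * q * s = t * w * t
  q_q : q * q = q
  w_w : w * w = w
  t_q : t * q = q
  q_t : q * t = q
  s_w : s * w = w
  w_s : w * s = w
  q_w : q * w = w * q
  t_b : t * b = c * t
  b_s : b * s = s * b
  q_c_q : q * c * q = q
  w_c_w : w * c * w = w
  c_q_c : c * q * c = c
  L_s : L * s = s * L
  L_w : L * w = w * L

/-- Relations between `u = s_n`, `t = s_{n+1}`, `s = s_{n+2}`, `r = p_{n+1/2}`, `q = p_{n+3/2}`,
`w = p_{n+5/2}`, `a = p_n`, `b = p_{n+1}`, `c = p_{n+2}`, `M = L_n` and `τ = σ_{n+1}`. -/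
structure LocalRelations {A : Type*} [Monoid A] (u t s r q w a b c M τ : A) : Prop where
  lower : AdjacentRelations u t r q a b M
  upper : AdjacentRelations t s q w b c M
  u_s : u * s = s * u
  u_w : u * w = w * u
  r_s : r * s = s * r
  r_w : r * w = w * r
  c_r : c * r = r * c
  c_u : c * u = u * c
  b_w : b * w = w * b
  M_b : M * b = b * M
  τ_s : τ * s = s * τ
  τ_w : τ * w = w * τ
  τ_u : τ * u = u * τ
  τ_u_q : τ * u * q = q * u * M * r * b * q
  q_u_τ : q * u * τ = q * b * r * M * u * q

section Adjacent

variable {A : Type*} [Monoid A] {t s q w b c L S : A}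

theorem AdjacentRelations.b_t (h : AdjacentRelations t s q w b c L) : b * t = t * c := by
  calc b * t = t * (t * b) * t := by rw [← mul_assoc t t, h.t_t, one_mul]
    _ = t * c := by rw [h.t_b, mul_assoc, mul_assoc, h.t_t, mul_one]

theorem AdjacentRelations.t_w (h : AdjacentRelations t s q w b c L) : t * w = s * q * s * t := by
  rw [h.s_q_s, mul_assoc, h.t_t, mul_one]

theorem AdjacentRelations.w_t (h : AdjacentRelations t s q w b c L) : w * t = t * s * q * s := by
  rw [mul_assoc t, mul_assoc t, h.s_q_s, mul_assoc, ← mul_assoc t, h.t_t, one_mul]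

theorem AdjacentRelations.op (h : AdjacentRelations t s q w b c L) :
    AdjacentRelations (MulOpposite.op t) (.op s) (.op q) (.op w) (.op b) (.op c) (.op L) := by
  constructor <;>
    simp only [← MulOpposite.op_mul, ← MulOpposite.op_one, MulOpposite.op_inj, ← mul_assoc]
  all_goals first
    | exact h.b_t
    | (cases h; assumption)
    | (cases h; symm; assumption)

theorem AdjacentRelations.q_s_q (h : AdjacentRelations t s q w b c L) : q * s * q = q * w := by
  have e1 : q * s * q = s * q * w := by
    have h1 := h.s_q_s; have h2 := h.s_s; have h3 := h.t_q; have h4 := h.q_w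
    clear h
    simp only [eq_iff_option_smul (A := A), mul_smul, one_smul] at *
    grind
  have e2 : q * s * q = w * q * s := by
    have h0 : q * s = s * t * w * t := by
      calc q * s = s * (s * q * s) := by simp only [← mul_assoc, h.s_s, one_mul]
        _ = _ := by rw [h.s_q_s]; simp only [mul_assoc]
    have h1 : s * q = t * w * t * s := by
      rw [← h.s_q_s, mul_assoc, h.s_s, mul_one]
    rw [mul_assoc, h1]; simp only [← mul_assoc, h.q_t, h.q_w]
    rw [mul_assoc w, h.q_t]
  calc q * s * q = w * (w * q * s) := by rw [e2]; simp only [← mul_assoc, h.w_w]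
    _ = w * (s * q * w) := by rw [← e2, e1]
    _ = q * w := by simp only [← mul_assoc, h.w_s]; rw [← h.q_w, mul_assoc, h.w_w]

theorem AdjacentRelations.w_t_w (h : AdjacentRelations t s q w b c L) : w * t * w = w * q := by
  have e1 : w * t * w = q * w * t := by
    rw [mul_assoc, h.t_w]; simp only [← mul_assoc, h.w_s, ← h.q_w]; rw [mul_assoc q, h.w_s]
  have e2 : w * t * w = t * w * q := by
    rw [h.w_t]; simp only [mul_assoc, h.s_w, h.q_w]
    rw [← mul_assoc s w, h.s_w]
  calc w * t * w = q * (q * w * t) := by rw [e1]; simp only [← mul_assoc, h.q_q]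
    _ = q * (t * w * q) := by rw [← e1, e2]
    _ = w * q := by simp only [← mul_assoc, h.q_t]; rw [h.q_w, mul_assoc, h.q_q]

theorem AdjacentRelations.mul_s_q (h : AdjacentRelations t s q w b c L)
    (hS : S * t * w = w * t * L * q * c * w) :
    S * s * q = t * s * q * L * t * w * c * q := by
  have h1 := h.s_s; have h2 := h.t_t; have h3 := h.s_q_s; have h4 := h.t_q; have h5 := h.q_t
  have h6 := h.t_b; have h7 := h.b_s; have h8 := h.L_s
  clear h
  simp only [eq_iff_option_smul (A := A), mul_smul, one_smul] at *
  have h9 : ∀ x : Option A, s • q • x = t • w • t • s • x := by grind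
  grind

theorem AdjacentRelations.q_s_mul (h : AdjacentRelations t s q w b c L)
    (hS : w * t * S = w * c * q * L * t * w) :
    q * s * S = q * c * w * t * L * q * s * t := by
  have := h.op.mul_s_q (S := MulOpposite.op S)
    (by simpa [mul_assoc] using congrArg MulOpposite.op hS)
  simpa [← MulOpposite.op_mul, mul_assoc] using this

theorem AdjacentRelations.tsSstq_eq (h : AdjacentRelations t s q w b c L)
    (hS : S * t * w = w * t * L * q * c * w) :
    t * s * S * s * t * q = s * q * L * t * w * c * q := by
  calc t * s * S * s * t * q = t * s * (S * s * q) := by simp only [mul_assoc, h.t_q]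
    _ = (t * s * t) * s * q * L * t * w * c * q := by rw [h.mul_s_q hS]; simp only [mul_assoc]
    _ = s * t * (s * s) * q * L * t * w * c * q := by rw [h.t_s_t]; simp only [mul_assoc]
    _ = s * q * L * t * w * c * q := by rw [h.s_s, mul_one, mul_assoc s, h.t_q]

theorem AdjacentRelations.sqLsqsq_eq (h : AdjacentRelations t s q w b c L) :
    s * q * L * s * q * s * q = q * c * w * t * L * q * s * q := by
  calc s * q * L * s * q * s * q = s * q * L * s * (q * s * q) := by simp only [mul_assoc]
    _ = s * q * L * (s * w) * q := by rw [h.q_s_q, h.q_w]; simp only [mul_assoc]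
    _ = s * (q * w) * L * q := by rw [h.s_w, mul_assoc _ L, h.L_w]; simp only [mul_assoc]
    _ = q * w * L * q := by rw [h.q_w, ← mul_assoc, h.s_w]
    _ = (q * c * q) * w * L * q := by rw [h.q_c_q]
    _ = q * c * (w * q) * L * q := by rw [← h.q_w]; simp only [mul_assoc]
    _ = q * c * w * t * (w * L) * q := by rw [← h.w_t_w]; simp only [mul_assoc]
    _ = q * c * w * t * L * (q * w) := by rw [← h.L_w, h.q_w]; simp only [mul_assoc]
    _ = q * c * w * t * L * q * s * q := by rw [← h.q_s_q]; simp only [mul_assoc]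

end Adjacent

section Local

variable {A : Type*} [Monoid A] {u t s r q w a b c M τ : A}

theorem LocalRelations.rMuqbr_eq (h : LocalRelations u t s r q w a b c M τ) :
    r * M * u * q * b * r = t * u * τ * t * r := by
  have h1 := h.lower.mul_s_q h.τ_u_q
  have h2 := h.lower.t_t; have h3 := h.upper.t_t
  clear h
  simp only [eq_iff_option_smul (A := A), mul_smul, one_smul] at *
  grind

theorem LocalRelations.rbquMr_eq (h : LocalRelations u t s r q w a b c M τ) :
    r * b * q * u * M * r = r * t * τ * u * t := by
  have h1 := h.lower.q_s_mul h.q_u_τ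
  have h2 := h.lower.t_t; have h3 := h.upper.t_t
  clear h
  simp only [eq_iff_option_smul (A := A), mul_smul, one_smul] at *
  grind

theorem LocalRelations.q_τ_u (h : LocalRelations u t s r q w a b c M τ) :
    q * τ * u = τ * u * q := by
  have h1 := h.upper.q_q; have h2 := h.τ_u_q; have h3 := h.q_u_τ; have h4 := h.τ_u
  clear h
  simp only [eq_iff_option_smul (A := A), mul_smul] at *
  grind

theorem LocalRelations.rMuqbr_eq_rbquMr (h : LocalRelations u t s r q w a b c M τ) :
    r * M * u * q * b * r = r * b * q * u * M * r := by
  rw [h.rMuqbr_eq, h.rbquMr_eq]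
  have h1 := h.q_τ_u; have h2 := h.τ_u; have h3 := h.lower.s_q_s; have h4 := h.lower.t_t
  have h5 := h.upper.t_t
  clear h
  simp only [eq_iff_option_smul (A := A), mul_smul, one_smul] at *
  grind

theorem LocalRelations.utτtu_t (h : LocalRelations u t s r q w a b c M τ) :
    u * t * τ * t * u * t = t * (u * t * τ * t * u) := by
  have h1 := h.lower.t_s_t; have h2 := h.τ_u; have h4 := h.lower.t_t; have h5 := h.upper.t_t
  clear h
  simp only [eq_iff_option_smul (A := A), mul_smul, one_smul] at *
  grind

theorem LocalRelations.utτtutw_eq_uwtuMrbtwu (h : LocalRelations u t s r q w a b c M τ) :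
    u * t * τ * t * u * t * w = u * w * t * u * M * r * b * t * w * u := by
  have h1 := h.lower.t_s_t; have h2 := h.τ_u; have h4 := h.lower.t_t; have h5 := h.upper.t_t
  have e1 : u * t * τ * t * u * t * w = u * t * τ * u * t * w * u := by
    have h3 := h.u_w
    clear h
    simp only [eq_iff_option_smul (A := A), mul_smul, one_smul] at *
    grind
  have e2 : u * t * τ * u * t * w * u = u * t * s * (τ * u * q) * s * t * u := by
    have h3 := h.upper.t_w
    have h6 := h.τ_s
    have h7 := h.u_s
    clear h
    simp only [eq_iff_option_smul (A := A), mul_smul, one_smul] at *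
    grind
  have e3 : u * t * s * q * u * M * r * b * q * s * t * u =
      u * w * t * u * M * r * b * t * w * u := by
    have h3 : s * (u * M * r * b) = u * M * r * b * s := Commute.eq <|
      ((Commute.mul_right h.u_s.symm h.upper.L_s.symm).mul_right h.r_s.symm)
        |>.mul_right h.upper.b_s.symm
    have h4 : t * s * q * (s * s) * (u * M * r * b) * q * s * t =
        t * s * q * s * (s * (u * M * r * b)) * q * s * t := by simp only [mul_assoc]
    rw [h.upper.s_s, mul_one, h3, ← h.upper.w_t] at h4
    have h5 (x : A) : t * (w * x) = s * (q * (s * (t * x))) := by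
      simp only [← mul_assoc, h.upper.t_w]
    have := congrArg (u * · * u) h4
    simp only [mul_assoc] at *
    rw [this, h5]
  rw [e1, e2, h.τ_u_q, ← e3]
  simp only [mul_assoc]

theorem LocalRelations.utτtutw_eq (h : LocalRelations u t s r q w a b c M τ) :
    u * t * τ * t * u * t * w = w * t * u * M * u * q * c * w := by
  rw [h.utτtutw_eq_uwtuMrbtwu]
  have e1 : u * w * t * u * M * r * b * t * w * u = w * u * t * u * M * r * t * c * w * u := by
    have h1 := h.upper.t_b; have h2 := h.upper.t_t; have h3 := h.u_w
    clear h
    simp only [eq_iff_option_smul (A := A), mul_smul, one_smul] at *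
    grind
  have e2 : w * u * t * u * M * r * t * c * w * u = w * t * u * M * (t * r * t) * c * w * u := by
    have h1 := h.lower.t_s_t; have h2 := h.lower.L_s
    clear h
    simp only [eq_iff_option_smul (A := A), mul_smul] at *
    grind
  rw [e1, e2, h.lower.s_q_s]
  have h1 := h.c_u; have h2 := h.u_w; have h3 := h.lower.t_t
  clear h
  simp only [eq_iff_option_smul (A := A), mul_smul, one_smul] at *
  grind

theorem LocalRelations.rbquMrw_eq (h : LocalRelations u t s r q w a b c M τ) :
    r * b * q * u * M * r * w = w * t * u * M * r * q * c * w := by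
  have e1 : r * b * q * u * M * r * w = r * t * s * (τ * u * q) * s * t := by
    rw [h.rbquMr_eq]
    have h3 := h.upper.t_w
    have h6 := h.τ_s
    have h7 := h.u_s
    have h2 := h.upper.w_w
    have h8 := h.upper.w_t
    have h9 := h.upper.t_t; have h10 := h.upper.s_q_s
    clear h
    simp only [eq_iff_option_smul (A := A), mul_smul, one_smul] at *
    grind
  have e2 : r * t * s * (q * u * M * r * b * q) * s * t =
      r * w * t * u * M * r * b * s * q * s * t := by
    have h3 : s * (u * M * r * b) = u * M * r * b * s := Commute.eq <|
      ((Commute.mul_right h.u_s.symm h.upper.L_s.symm).mul_right h.r_s.symm)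
        |>.mul_right h.upper.b_s.symm
    have h4 : t * s * q * (s * s) * (u * M * r * b) * q * s * t =
        t * s * q * s * (s * (u * M * r * b)) * q * s * t := by simp only [mul_assoc]
    rw [h.upper.s_s, mul_one, h3, ← h.upper.w_t] at h4
    have := congrArg (r * ·) h4
    simp only [mul_assoc] at *
    rw [this]
  have rt : r * t = t * u * q * u := by
    calc r * t = t * (t * r * t) := by simp only [← mul_assoc, h.upper.t_t, one_mul]
      _ = _ := by rw [h.lower.s_q_s, mul_assoc, mul_assoc, mul_assoc]
  calc _ = r * t * s * (q * u * M * r * b * q) * s * t := by rw [e1, h.τ_u_q]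
    _ = w * (r * t) * u * M * r * b * (s * q * s) * t := by
      rw [e2, h.r_w]; simp only [mul_assoc]
    _ = w * t * u * q * (u * u) * M * r * (b * t) * w * (t * t) := by
      rw [rt, h.upper.s_q_s]; simp only [mul_assoc]
    _ = w * t * u * (q * M * r * t) * c * w := by
      rw [h.upper.b_t, h.lower.t_t, h.upper.t_t, mul_one, mul_one]; simp only [mul_assoc]
    _ = w * t * u * M * r * q * c * w := by
      rw [← h.lower.L_w, mul_assoc M, ← h.lower.q_w, mul_assoc M, mul_assoc r, h.upper.q_t]
      simp only [mul_assoc]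

theorem LocalRelations.wtrMuqcw_eq (h : LocalRelations u t s r q w a b c M τ) :
    w * t * r * M * u * q * c * w = t * r * M * u * q * b * r * t * w := by
  have e1 : t * r * M * u * q * b * r * t * w = u * τ * u * q * u * w := by
    have := congrArg (t * · * t * w) h.rMuqbr_eq
    have h1 := h.lower.s_q_s; have h2 := h.upper.t_t; have h3 := h.u_w
    clear h
    simp only [eq_iff_option_smul (A := A), mul_smul, one_smul] at *
    grind
  have e2 : w * t * r * M * u * q * c * w = w * u * q * u * M * t * u * q * c * w := by
    have h1 := h.lower.s_q_s; have h2 := h.upper.t_t; have h3 := h.lower.L_s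
    clear h
    simp only [eq_iff_option_smul (A := A), mul_smul, one_smul] at *
    grind
  have e3 : w * u * q * u * M * t * u * q * c * w = u * w * q * u * M * r * t * c * w * u := by
    have h1 := h.lower.s_q_s; have h2 := h.upper.t_t; have h3 := h.u_w; have h4 := h.c_u
    have h5 := h.lower.t_t
    clear h
    simp only [eq_iff_option_smul (A := A), mul_smul, one_smul] at *
    grind
  have e4 : w * (q * u * M * r * b) = q * u * M * r * b * w := Commute.eq <|
    (((Commute.mul_right h.upper.q_w.symm h.u_w.symm).mul_right h.upper.L_w.symm)
      |>.mul_right h.r_w.symm).mul_right h.b_w.symm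
  calc _ = u * (w * (q * u * M * r * b)) * t * w * u := by
        rw [e2, e3]; simp only [mul_assoc]; rw [← mul_assoc t, ← mul_assoc b, h.upper.b_t]
    _ = u * (q * u * M * r * b) * (w * t * w) * u := by rw [e4]; simp only [mul_assoc]
    _ = u * (w * (q * u * M * r * b)) * q * u := by rw [h.upper.w_t_w, e4]; simp only [mul_assoc]
    _ = u * (w * (τ * u * q)) * u := by rw [h.τ_u_q]; simp only [mul_assoc]
    _ = u * (τ * u * q * w) * u := by
      rw [Commute.eq ((Commute.mul_right h.τ_w.symm h.u_w.symm).mul_right h.upper.q_w.symm)]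
    _ = _ := by rw [e1]; simp only [mul_assoc, h.u_w]

theorem LocalRelations.wtrMbrqcw_eq (h : LocalRelations u t s r q w a b c M τ) :
    w * t * r * M * b * r * q * c * w = t * r * M * t * r * w := by
  have trq : t * r * q = q * r := by rw [mul_assoc, h.lower.q_w, ← mul_assoc, h.upper.t_q]
  have e1 : w * t * r * M * b * r * q * c * w = w * u * q * u * M * c * q * r * c * w := by
    have h1 := h.lower.s_q_s; have h2 := h.upper.t_t; have h3 := h.lower.L_s; have h4 := h.upper.t_b
    clear h
    simp only [eq_iff_option_smul (A := A), mul_smul, one_smul] at *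
    grind
  have e2 : w * u * q * u * M * c * q * r * c * w = u * q * u * M * r * w := by
    have h1 := h.c_r; have h2 := h.upper.c_q_c; have h3 := h.upper.w_c_w
    have h4 : w * (u * q * u * M) = u * q * u * M * w := Commute.eq <|
      ((Commute.mul_right h.u_w.symm h.upper.q_w.symm).mul_right h.u_w.symm)
        |>.mul_right h.upper.L_w.symm
    have h5 := h.r_w
    clear e1 trq h
    simp only [eq_iff_option_smul (A := A), mul_smul] at *
    grind
  rw [e1, e2]
  have h1 := h.lower.s_q_s; have h3 := h.lower.L_s
  clear e1 e2 trq h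
  simp only [eq_iff_option_smul (A := A), mul_smul] at *
  grind

theorem LocalRelations.wtτqcw_eq (h : LocalRelations u t s r q w a b c M τ) :
    w * t * τ * q * c * w = r * M * t * r * t * w := by
  have e1 : w * t * τ * q * c * w = w * (t * u * τ * t * r) * b * t * w * u := by
    have h1 := h.lower.s_q_s; have h2 := h.lower.t_t; have h3 := h.τ_u; have h4 := h.upper.b_t
    have h5 := h.u_w; have h6 := h.c_u; have h7 := h.upper.t_t
    clear h
    simp only [eq_iff_option_smul (A := A), mul_smul, one_smul] at *
    grind
  have e2 : w * (r * M * u * q) = r * M * u * q * w := Commute.eq <|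
      ((Commute.mul_right h.r_w.symm h.upper.L_w.symm).mul_right h.u_w.symm)
        |>.mul_right h.upper.q_w.symm
  calc _ = (w * (r * M * u * q)) * (b * r * b) * t * w * u := by
        rw [e1, ← h.rMuqbr_eq]; simp only [mul_assoc]
    _ = r * M * u * q * (w * b) * t * w * u := by rw [h.lower.c_q_c, e2]; simp only [mul_assoc]
    _ = r * M * u * (q * b) * (w * t * w) * u := by rw [← h.b_w]; simp only [mul_assoc]
    _ = r * M * u * (q * b * q) * w * u := by
      rw [h.upper.w_t_w, ← h.upper.q_w]; simp only [mul_assoc]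
    _ = r * M * (u * q * u) * w := by rw [h.lower.w_c_w]; simp only [mul_assoc, h.u_w]
    _ = _ := by rw [← h.lower.s_q_s]; simp only [mul_assoc]

theorem LocalRelations.op (h : LocalRelations u t s r q w a b c M τ) :
    LocalRelations (MulOpposite.op u) (.op t) (.op s) (.op r) (.op q) (.op w) (.op a) (.op b)
      (.op c) (.op M) (.op τ) where
  lower := h.lower.op
  upper := h.upper.op
  u_s := congrArg _ h.u_s.symm
  u_w := congrArg _ h.u_w.symm
  r_s := congrArg _ h.r_s.symm
  r_w := congrArg _ h.r_w.symm
  c_r := congrArg _ h.c_r.symm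
  c_u := congrArg _ h.c_u.symm
  b_w := congrArg _ h.b_w.symm
  M_b := congrArg _ h.M_b.symm
  τ_s := congrArg _ h.τ_s.symm
  τ_w := congrArg _ h.τ_w.symm
  τ_u := congrArg _ h.τ_u.symm
  τ_u_q := by simpa only [← MulOpposite.op_mul, MulOpposite.op_inj, ← mul_assoc] using h.q_u_τ
  q_u_τ := by simpa only [← MulOpposite.op_mul, MulOpposite.op_inj, ← mul_assoc] using h.τ_u_q

end Local

section Step

variable {A : Type*} [Ring A] {u t s r q w a b c M τ : A}

/-- The recursion expressing `σ_{n+2}` in terms of `M = L_n` and `τ = σ_{n+1}`. -/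
def sigNext (u t r q b M τ : A) : A :=
  u * t * τ * t * u + t * r * M * t * r * t + r * M * t * r
    - t * r * M * u * q * b * r - r * b * q * u * M * r * t

/-- The recursion expressing `L_{n+1}` in terms of `M = L_n` and `τ = σ_{n+1}`. -/
def LNext (u r b M τ : A) : A :=
  -(u * M * r) - r * M * u + r * M * b * r + u * M * u + τ

theorem sigNext_op (h : M * t = t * M) :
    sigNext (MulOpposite.op u) (.op t) (.op r) (.op q) (.op b) (.op M) (.op τ) =
      .op (sigNext u t r q b M τ) := by
  have h1 : t * r * M * t * r * t = t * r * t * M * r * t := by rw [mul_assoc _ M, h, ← mul_assoc]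
  have h2 : r * M * t * r = r * t * M * r := by rw [mul_assoc _ M, h, ← mul_assoc]
  simp only [sigNext, ← MulOpposite.op_mul, ← MulOpposite.op_add, ← MulOpposite.op_sub,
    MulOpposite.op_inj, h1, h2, ← mul_assoc]
  abel

theorem LNext_op (h : M * b = b * M) :
    LNext (MulOpposite.op u) (.op r) (.op b) (.op M) (.op τ) = .op (LNext u r b M τ) := by
  have h1 : r * M * b * r = r * b * M * r := by rw [mul_assoc _ M, h, ← mul_assoc]
  simp only [LNext, ← MulOpposite.op_mul, ← MulOpposite.op_add, ← MulOpposite.op_sub,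
    ← MulOpposite.op_neg, MulOpposite.op_inj, h1, ← mul_assoc]
  abel

theorem LocalRelations.sigNext_mul (h : LocalRelations u t s r q w a b c M τ) :
    sigNext u t r q b M τ * t * w = w * t * LNext u r b M τ * q * c * w := by
  have e : r * b * q * u * M * r * t * t * w = w * t * u * M * r * q * c * w := by
    rw [mul_assoc _ t t, h.upper.t_t, mul_one, h.rbquMrw_eq]
  have e2 : t * r * M * t * r * t * t * w = w * t * r * M * b * r * q * c * w := by
    rw [mul_assoc _ t t, h.upper.t_t, mul_one, h.wtrMbrqcw_eq]
  simp only [sigNext, LNext, add_mul, sub_mul, mul_add, mul_sub, mul_neg, neg_mul, ← mul_assoc,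
    h.utτtutw_eq, e, h.wtrMuqcw_eq, e2, h.wtτqcw_eq]
  abel

theorem LocalRelations.sigNext_comm (h : LocalRelations u t s r q w a b c M τ) :
    sigNext u t r q b M τ * t = t * sigNext u t r q b M τ := by
  have e1 := h.utτtu_t
  have e2 : t * (t * r * M * t * r * t) = r * M * t * r * t := by
    simp only [← mul_assoc, h.upper.t_t, one_mul]
  have e3 : t * r * M * t * r * t * t = t * (r * M * t * r) := by
    rw [mul_assoc _ t t, h.upper.t_t, mul_one]; simp only [mul_assoc]
  have e4 : t * r * M * u * q * b * r * t = t * (r * b * q * u * M * r * t) := by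
    have := congrArg (t * · * t) (h.rMuqbr_eq_rbquMr)
    simpa only [mul_assoc] using this
  have e5 : r * b * q * u * M * r * t * t = t * (t * r * M * u * q * b * r) := by
    rw [mul_assoc _ t t, h.upper.t_t, mul_one]; simp only [← mul_assoc, h.upper.t_t, one_mul]
    exact (h.rMuqbr_eq_rbquMr).symm
  simp only [sigNext, add_mul, sub_mul, mul_add, mul_sub, e1, e2, e3, e4, e5]
  abel

theorem LocalRelations.mul_sigNext (h : LocalRelations u t s r q w a b c M τ) :
    w * t * sigNext u t r q b M τ = w * c * q * LNext u r b M τ * t * w := by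
  have := h.op.sigNext_mul
  rw [sigNext_op h.lower.L_s, LNext_op h.M_b] at this
  simpa only [← MulOpposite.op_mul, MulOpposite.op_inj, ← mul_assoc] using this

theorem AdjacentRelations.sigNext_mul_q {L S : A} (h : AdjacentRelations t s q w b c L)
    (hS : S * t * w = w * t * L * q * c * w) :
    sigNext t s q w c L S * q = q * L * s * q := by
  simp only [sigNext, add_mul, sub_mul, h.tsSstq_eq hS, h.sqLsqsq_eq]
  simp only [mul_assoc, h.q_q]
  abel

theorem AdjacentRelations.q_mul_sigNext {L S : A} (h : AdjacentRelations t s q w b c L)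
    (hS : w * t * S = w * c * q * L * t * w) :
    q * sigNext t s q w c L S = q * L * s * q := by
  have := h.op.sigNext_mul_q (S := MulOpposite.op S)
    (by simpa [mul_assoc] using congrArg MulOpposite.op hS)
  rw [sigNext_op h.L_s] at this
  simp only [← MulOpposite.op_mul, MulOpposite.op_inj] at this
  rw [this, mul_assoc q L s, h.L_s]
  simp only [mul_assoc]

end Step

theorem AdjacentRelations.base {A : Type*} [Monoid A] {t s q w b c L : A}
    (h : AdjacentRelations t s q w b c L) :
    t * t * w = w * t * b * q * c * w := by
  rw [h.t_t, one_mul, mul_assoc w t, h.t_b]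
  simp only [mul_assoc]
  rw [← mul_assoc t q, h.t_q, ← mul_assoc q, ← mul_assoc c, ← mul_assoc c, h.c_q_c, ← mul_assoc,
    h.w_c_w]

section Generators

variable {k : ℕ} {A : Type*} [Ring A] [Algebra (Polynomial ℤ) A] (P : PartitionAlgebra k A)

theorem L_one : P.L 1 = P.p 1 := rfl

theorem sig_two : P.sig 2 = P.s 1 := rfl

theorem sig_add_two {n : ℕ} (hn : 1 ≤ n) :
    P.sig (n + 2) = sigNext (P.s n) (P.s (n + 1)) (P.q n) (P.q (n + 1)) (P.p (n + 1)) (P.L n)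
      (P.sig (n + 1)) := by
  simp [sig, L, LS, sigNext, Nat.one_le_iff_ne_zero.mp hn]

theorem L_add_two (n : ℕ) :
    P.L (n + 2) = LNext (P.s (n + 1)) (P.q (n + 1)) (P.p (n + 2)) (P.L (n + 1))
      (P.sig (n + 2)) := rfl

/-- An element commuting with the generators that occur in `L_n` and `σ_n` commutes with both. -/
theorem commute_L_sig {x : A} (n : ℕ) (hs : ∀ i, 1 ≤ i → i < n → Commute x (P.s i))
    (hq : ∀ i, 1 ≤ i → i < n → Commute x (P.q i)) (hp : ∀ i, 1 ≤ i → i ≤ n → Commute x (P.p i)) :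
    Commute x (P.L n) ∧ Commute x (P.sig n) := by
  induction n using Nat.twoStepInduction with
  | zero => exact ⟨Commute.zero_right x, Commute.one_right x⟩
  | one => exact ⟨hp 1 le_rfl le_rfl, Commute.one_right x⟩
  | more n ih₀ ih₁ =>
    obtain ⟨hL₀, -⟩ := ih₀ (fun i h _ => hs i h (by omega)) (fun i h _ => hq i h (by omega))
      (fun i h _ => hp i h (by omega))
    obtain ⟨hL₁, hσ₁⟩ := ih₁ (fun i h _ => hs i h (by omega)) (fun i h _ => hq i h (by omega))
      (fun i h _ => hp i h (by omega))
    have hs₁ := hs (n + 1) (by omega) (by omega)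
    have hq₁ := hq (n + 1) (by omega) (by omega)
    have hp₂ := hp (n + 2) (by omega) (by omega)
    have hσ : Commute x (P.sig (n + 2)) := by
      rcases Nat.eq_zero_or_pos n with rfl | hn
      · exact hs₁
      · have hs₀ := hs n hn (by omega)
        have hq₀ := hq n hn (by omega)
        have hp₁ := hp (n + 1) (by omega) (by omega)
        rw [P.sig_add_two hn, sigNext]
        repeat' first | assumption | apply Commute.add_right | apply Commute.sub_right |
          apply Commute.mul_right
    refine ⟨?_, hσ⟩
    rw [L_add_two, LNext]
    repeat' first | assumption | apply Commute.add_right | apply Commute.sub_right |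
      apply Commute.mul_right | apply Commute.neg_right

theorem s_commute_L_sig {n j : ℕ} (hn : n < j) (hj : j ≤ k - 1) :
    Commute (P.s j) (P.L n) ∧ Commute (P.s j) (P.sig n) :=
  P.commute_L_sig n
    (fun i _ _ => P.s_comm j i (by omega) hj (by omega) (by omega) (by omega) (by omega))
    (fun i _ _ => P.s_q' j i (by omega) hj (by omega) (by omega) (by omega) (by omega))
    (fun i _ _ => P.s_p j i (by omega) hj (by omega) (by omega) (by omega) (by omega))

theorem q_commute_L_sig {n j : ℕ} (hn : n < j) (hj : j ≤ k - 1) :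
    Commute (P.q j) (P.L n) ∧ Commute (P.q j) (P.sig n) :=
  P.commute_L_sig n
    (fun i _ _ => (P.s_q' i j (by omega) (by omega) (by omega) hj (by omega) (by omega)).symm)
    (fun i _ _ => P.q_comm j i (by omega) hj (by omega) (by omega))
    (fun i _ _ => P.q_p j i (by omega) hj (by omega) (by omega) (by omega) (by omega))

theorem p_commute_L_sig {n j : ℕ} (hn : n < j) (hj : j ≤ k) :
    Commute (P.p j) (P.L n) ∧ Commute (P.p j) (P.sig n) :=
  P.commute_L_sig n
    (fun i _ _ => (P.s_p i j (by omega) (by omega) (by omega) hj (by omega) (by omega)).symm)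
    (fun i _ _ => (P.q_p i j (by omega) (by omega) (by omega) hj (by omega) (by omega)).symm)
    (fun i _ _ => P.p_comm j i (by omega) hj (by omega) (by omega))

theorem adjacentRelations {n : ℕ} (hn : 1 ≤ n) (hk : n + 1 ≤ k - 1) {x : A}
    (hs : Commute (P.s (n + 1)) x) (hq : Commute (P.q (n + 1)) x) :
    AdjacentRelations (P.s n) (P.s (n + 1)) (P.q n) (P.q (n + 1)) (P.p n) (P.p (n + 1)) x where
  t_t := P.s_sq n hn (by omega)
  s_s := P.s_sq (n + 1) (by omega) hk
  t_s_t := P.braid n hn hk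
  s_q_s := P.sqs (n + 1) (by omega) hk
  q_q := P.q_sq n hn (by omega)
  w_w := P.q_sq (n + 1) (by omega) hk
  t_q := P.s_q n hn (by omega)
  q_t := P.q_s n hn (by omega)
  s_w := P.s_q (n + 1) (by omega) hk
  w_s := P.q_s (n + 1) (by omega) hk
  q_w := P.q_comm n (n + 1) hn (by omega) (by omega) hk
  t_b := by
    rw [← P.sps n hn (by omega), mul_assoc _ (P.s n), P.s_sq n hn (by omega), mul_one]
  b_s := (P.s_p (n + 1) n (by omega) hk hn (by omega) (by omega) (by omega)).symm
  q_c_q := P.qpq₂ n hn (by omega)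
  w_c_w := P.qpq₁ (n + 1) (by omega) hk
  c_q_c := P.pqp₁ (n + 1) (by omega) (by omega)
  L_s := hs.eq.symm
  L_w := hq.eq.symm

theorem adjacentRelations_L {n : ℕ} (hn : 1 ≤ n) (hk : n + 1 ≤ k - 1) :
    AdjacentRelations (P.s n) (P.s (n + 1)) (P.q n) (P.q (n + 1)) (P.p n) (P.p (n + 1)) (P.L n) :=
  P.adjacentRelations hn hk (P.s_commute_L_sig (by omega) hk).1
    (P.q_commute_L_sig (by omega) hk).1

theorem sig_relations {n : ℕ} (hn : 1 ≤ n) (hk : n + 1 ≤ k - 1) :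
    P.sig (n + 1) * P.s n * P.q (n + 1) =
        P.q (n + 1) * P.s n * P.L n * P.q n * P.p (n + 1) * P.q (n + 1) ∧
      P.q (n + 1) * P.s n * P.sig (n + 1) =
        P.q (n + 1) * P.p (n + 1) * P.q n * P.L n * P.s n * P.q (n + 1) ∧
      P.sig (n + 1) * P.s n = P.s n * P.sig (n + 1) := by
  induction n, hn using Nat.le_induction with
  | base =>
    have h := P.adjacentRelations_L le_rfl hk
    rw [sig_two, L_one]
    rw [L_one] at h
    refine ⟨h.base, ?_, rfl⟩
    have := h.op.base
    simp only [← MulOpposite.op_mul, MulOpposite.op_inj] at this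
    simpa only [mul_assoc] using this
  | succ n hn ih =>
    obtain ⟨h₁, h₂, h₃⟩ := ih (by omega)
    have h : LocalRelations (P.s n) (P.s (n + 1)) (P.s (n + 2)) (P.q n) (P.q (n + 1))
        (P.q (n + 2)) (P.p n) (P.p (n + 1)) (P.p (n + 2)) (P.L n) (P.sig (n + 1)) :=
      { lower := P.adjacentRelations_L hn (by omega)
        upper := P.adjacentRelations (by omega) hk (P.s_commute_L_sig (by omega) hk).1
          (P.q_commute_L_sig (by omega) hk).1
        u_s := P.s_comm n (n + 2) hn (by omega) (by omega) hk (by omega) (by omega)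
        u_w := P.s_q' n (n + 2) hn (by omega) (by omega) hk (by omega) (by omega)
        r_s := (P.s_q' (n + 2) n (by omega) hk hn (by omega) (by omega) (by omega)).symm
        r_w := P.q_comm n (n + 2) hn (by omega) (by omega) hk
        c_r := (P.q_p n (n + 2) hn (by omega) (by omega) (by omega) (by omega) (by omega)).symm
        c_u := (P.s_p n (n + 2) hn (by omega) (by omega) (by omega) (by omega) (by omega)).symm
        b_w := (P.q_p (n + 2) (n + 1) (by omega) hk (by omega) (by omega) (by omega)
          (by omega)).symm
        M_b := (P.p_commute_L_sig (by omega) (by omega)).1.eq.symm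
        τ_s := (P.s_commute_L_sig (by omega) hk).2.eq.symm
        τ_w := (P.q_commute_L_sig (by omega) hk).2.eq.symm
        τ_u := h₃
        τ_u_q := h₁
        q_u_τ := h₂ }
    have hL : P.L (n + 1) = LNext (P.s n) (P.q n) (P.p (n + 1)) (P.L n) (P.sig (n + 1)) := by
      obtain ⟨m, rfl⟩ := Nat.exists_eq_add_of_le' hn
      exact P.L_add_two m
    rw [P.sig_add_two hn, hL]
    exact ⟨h.sigNext_mul, h.mul_sigNext, h.sigNext_comm⟩

end Generators

end PartitionAlgebra

/-- Theorem 3.6(1): `σ_{i+1} p_{i-1/2} = p_{i-1/2} σ_{i+1} = p_{i-1/2} L_{i-1} s_i p_{i-1/2}`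
for `2 ≤ i ≤ k-1`. -/
theorem partitionAlgebra_sig_comm_qlow {k : ℕ} (hk : 3 ≤ k) {A : Type*} [Ring A]
    [Algebra (Polynomial ℤ) A] (P : PartitionAlgebra k A) :
    ∀ i, 2 ≤ i → i ≤ k - 1 →
      P.sig (i + 1) * P.q (i - 1) = P.q (i - 1) * P.sig (i + 1) ∧
      P.q (i - 1) * P.sig (i + 1) = P.q (i - 1) * P.L (i - 1) * P.s i * P.q (i - 1) := by
  intro i hi hik
  obtain ⟨n, rfl⟩ := Nat.exists_eq_add_of_le' (show 1 ≤ i by omega)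
  have hn : 1 ≤ n := by omega
  obtain ⟨h₁, h₂, -⟩ := P.sig_relations hn hik
  have h := P.adjacentRelations_L hn hik
  rw [Nat.add_sub_cancel, P.sig_add_two hn, h.q_mul_sigNext h₂]
  exact ⟨h.sigNext_mul_q h₁, rfl⟩
end

section
/- In the partition algebra A_k(z): the element σ_{i+1/2} commutes with p_{i−1} for every i with 2 ≤ i ≤ k−1, and σ_{i+1/2} commutes with each of p_{i−3/2}, s_{i−2}, and p_{i−2} for every i with 3 ≤ i ≤ k−1. -/
open Polynomial

namespace PartitionAlgebra

section Swap

variable {A : Type*} [Ring A]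

/-- The element acting as the transposition `(a b)` on a tensor position, when `x` and `y` are the
idempotents requiring that position to agree with `a` and with `b`, and `p` forgets it. -/
def swap (p x y : A) : A := 1 - x - y + y * p * x + x * p * y

theorem swap_symm (p x y : A) : swap p x y = swap p y x := by
  unfold swap; abel

theorem swap_mul_self_right {p x y : A} (hx : p * x * p = p) (hy : p * y * p = p) :
    swap p x y * p = p := by
  have h1 : y * p * x * p = y * p := by grind
  have h2 : x * p * y * p = x * p := by grind
  simp only [swap, add_mul, sub_mul, h1, h2, one_mul]
  abel

theorem swap_mul_self_left {p x y : A} (hx : p * x * p = p) (hy : p * y * p = p) :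
    p * swap p x y = p := by
  have h1 : p * (y * p * x) = p * x := by grind
  have h2 : p * (x * p * y) = p * y := by grind
  simp only [swap, mul_add, mul_sub, h1, h2, mul_one]
  abel

theorem commute_swap {a p x y : A} (hp : Commute a p) (hx : Commute a x) (hy : Commute a y) :
    Commute a (swap p x y) :=
  ((((Commute.one_right a).sub_right hx).sub_right hy).add_right
    ((hy.mul_right hp).mul_right hx)).add_right ((hx.mul_right hp).mul_right hy)

theorem mul_swap_mul {w w' p x y : A} (h : w' * w = 1) (h' : w * w' = 1) :
    w * swap p x y * w' = swap (w * p * w') (w * x * w') (w * y * w') := by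
  have h1 : w * (y * p * x) * w' = (w * y * w') * (w * p * w') * (w * x * w') := by grind
  have h2 : w * (x * p * y) * w' = (w * x * w') * (w * p * w') * (w * y * w') := by grind
  simp only [swap, mul_add, mul_sub, add_mul, sub_mul, h1, h2, mul_one, h']

theorem mul_swap_left {p x y : A} (hx : x * x = x) (hxp : x * p * x = x) (hxy : x * y = y * x) :
    x * swap p x y = x * p * y := by
  have h1 : x * (y * p * x) = x * y := by
    rw [← mul_assoc, ← mul_assoc, hxy, mul_assoc y, mul_assoc y, hxp]
  have h2 : x * (x * p * y) = x * p * y := by simp only [← mul_assoc, hx]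
  simp only [swap, mul_add, mul_sub, mul_one, hx, h1, h2]
  abel

theorem mul_mul_swap {q p x y p' x' y' : A}
    (hy' : y' * y' = y') (hyp' : y' * p' * y' = y') (hxy' : x' * y' = y' * x')
    (hpy : p * y' = y' * p) (hxy : x * y' = y' * x)
    (hqy : q * y = q * y') (hyq : q * y = y * y') :
    q * (y * p * x) * swap p' x' y' = y * p * x * (y' * p' * x') := by
  have h1 : y * p * x * y' = q * y * p * x := by
    rw [hyq, mul_assoc _ x, hxy, ← mul_assoc, mul_assoc y p, hpy, ← mul_assoc]
  have h2 : q * (q * y) = q * y := by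
    rw [hyq, ← mul_assoc, hqy, mul_assoc, hy', ← hqy, hyq]
  have h3 : q * (y * p * x) = q * (y * p * x) * y' := by
    rw [mul_assoc q, h1]; simp only [← mul_assoc]; rw [mul_assoc q q y, h2]
  rw [h3, mul_assoc, swap_symm, mul_swap_left hy' hyp' hxy'.symm]
  simp only [← mul_assoc] at h3 ⊢
  rw [← h3, ← h1]

/-- The product of two swaps on positions identified by `q`. -/
theorem mul_swap_mul_swap {q p x y p' x' y' : A}
    (hx' : x' * x' = x') (hy' : y' * y' = y') (hxy' : x' * y' = y' * x')
    (hxp' : x' * p' * x' = x') (hyp' : y' * p' * y' = y')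
    (hpx : p * x' = x' * p) (hpy : p * y' = y' * p)
    (hxy : x * y' = y' * x) (hyx : y * x' = x' * y)
    (hqx : q * x = q * x') (hqy : q * y = q * y') (hxq : q * x = x * x')
    (hyq : q * y = y * y') :
    q * (swap p x y * swap p' x' y') =
      q - q * x - q * y + y * p * x * (y' * p' * x') + x * p * y * (x' * p' * y') := by
  have h1 := mul_mul_swap hy' hyp' hxy' hpy hxy hqy hyq
  have h2 := mul_mul_swap hx' hxp' hxy'.symm hpx hyx hqx hxq
  rw [swap_symm p' y' x'] at h2
  have h3 := mul_swap_left (p := p') hx' hxp' hxy'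
  have h4 := mul_swap_left (p := p') hy' hyp' hxy'.symm
  rw [swap_symm p' y' x'] at h4
  rw [← mul_assoc, swap.eq_def p x y]
  simp only [mul_add, mul_sub, add_mul, sub_mul, mul_one, h1, h2]
  rw [hqx, hqy, mul_assoc q x', mul_assoc q y', h3, h4, swap.eq_def p' x' y']
  simp only [mul_add, mul_sub, mul_one]
  abel

theorem op_swap (p x y : A) : MulOpposite.op (swap p x y) =
    swap (MulOpposite.op p) (MulOpposite.op x) (MulOpposite.op y) := by
  simp only [swap, MulOpposite.op_add, MulOpposite.op_sub, MulOpposite.op_mul, MulOpposite.op_one,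
    mul_assoc]
  abel

/-- Two swaps on positions identified by `q` have a product commuting with `q`. -/
theorem commute_swap_mul_swap {q p x y p' x' y' : A}
    (hx' : x' * x' = x') (hy' : y' * y' = y') (hxy' : Commute x' y')
    (hxp' : x' * p' * x' = x') (hyp' : y' * p' * y' = y')
    (hpp : Commute p p') (hpx : Commute p x') (hpy : Commute p y')
    (hxp : Commute x p') (hxx : Commute x x') (hxy : Commute x y')
    (hyp : Commute y p') (hyx : Commute y x') (hyy : Commute y y')
    (hqx : Commute q x) (hqy : Commute q y) (hqx' : Commute q x') (hqy' : Commute q y')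
    (hqxx : q * x = q * x') (hqyy : q * y = q * y') (hxxq : q * x = x * x')
    (hyyq : q * y = y * y') :
    Commute q (swap p x y * swap p' x' y') := by
  have hu : Commute (y * p * x) (y' * p' * x') :=
    ((((hyy.mul_right hyp).mul_right hyx).mul_left ((hpy.mul_right hpp).mul_right hpx))).mul_left
      ((hxy.mul_right hxp).mul_right hxx)
  have hv : Commute (x * p * y) (x' * p' * y') :=
    ((((hxx.mul_right hxp).mul_right hxy).mul_left ((hpx.mul_right hpp).mul_right hpy))).mul_left
      ((hyx.mul_right hyp).mul_right hyy)
  have hs : Commute (swap p x y) (swap p' x' y') :=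
    commute_swap (commute_swap hpp.symm hxp.symm hyp.symm).symm
      (commute_swap hpx.symm hxx.symm hyx.symm).symm (commute_swap hpy.symm hxy.symm hyy.symm).symm
  have h1 := mul_swap_mul_swap hx' hy' hxy' hxp' hyp' hpx hpy hxy hyx hqxx hqyy hxxq hyyq
  have op {a b : A} (h : Commute a b) :
      MulOpposite.op a * MulOpposite.op b = MulOpposite.op b * MulOpposite.op a := by
    rw [← MulOpposite.op_mul, ← MulOpposite.op_mul, h.eq]
  have h2 := mul_swap_mul_swap (q := MulOpposite.op q) (p := MulOpposite.op p)
    (x := MulOpposite.op x) (y := MulOpposite.op y) (p' := MulOpposite.op p')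
    (x' := MulOpposite.op x') (y' := MulOpposite.op y')
    (by rw [← MulOpposite.op_mul, hx']) (by rw [← MulOpposite.op_mul, hy']) (op hxy')
    (by rw [← MulOpposite.op_mul, ← MulOpposite.op_mul, ← mul_assoc, hxp'])
    (by rw [← MulOpposite.op_mul, ← MulOpposite.op_mul, ← mul_assoc, hyp'])
    (op hpx) (op hpy) (op hxy) (op hyx)
    (by rw [op hqx, op hqx', ← MulOpposite.op_mul, ← MulOpposite.op_mul, hqxx])
    (by rw [op hqy, op hqy', ← MulOpposite.op_mul, ← MulOpposite.op_mul, hqyy])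
    (by rw [op hqx, op hxx, ← MulOpposite.op_mul, ← MulOpposite.op_mul, hxxq])
    (by rw [op hqy, op hyy, ← MulOpposite.op_mul, ← MulOpposite.op_mul, hyyq])
  simp only [← op_swap, ← MulOpposite.op_mul, ← MulOpposite.op_add, ← MulOpposite.op_sub] at h2
  have h3 := MulOpposite.op_injective h2
  rw [Commute, SemiconjBy, h1, hs.eq, h3, ← hqx.eq, ← hqy.eq, hu.eq, hv.eq]
  simp only [mul_assoc]
  abel

end Swap

theorem commute_conj {M : Type*} [Monoid M] {w w' a z z' : M} (h : w * w' = 1) (h' : w' * w = 1)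
    (hz : z * w = w * z') (ha : Commute a z') : Commute (w * a * w') z := by
  have h2 : w' * z = z' * w' := by
    calc w' * z = w' * (z * w) * w' := by simp only [mul_assoc, h, mul_one]
      _ = z' * w' := by rw [hz, ← mul_assoc, h', one_mul]
  calc w * a * w' * z = w * (a * z') * w' := by rw [mul_assoc _ w', h2]; simp only [mul_assoc]
    _ = z * (w * a * w') := by rw [ha.eq]; simp only [← mul_assoc]; rw [hz]

variable {k : ℕ} {A : Type*} [Ring A] [Algebra (Polynomial ℤ) A] (P : PartitionAlgebra k A)

/-- The element identifying positions `j` and `j + 2`. -/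
def r (j : ℕ) : A := P.s (j + 1) * P.q j * P.s (j + 1)

/-- The transposition of the entries at `j + 1` and `j + 2`, acting on position `j`. -/
def tau (j : ℕ) : A := swap (P.p j) (P.q j) (P.r j)

/-- The shift of `σ_{j+1/2}` by one step on the positions `j` and `j + 1`. -/
def shiftSigH (j : ℕ) : A := P.s j * P.s (j + 1) * P.sigH j * P.s (j + 1) * P.s j

theorem sigH_one : P.sigH 1 = 1 := by simp [sigH, LSh]

theorem sigH_succ (j : ℕ) (hj : 1 ≤ j) : P.sigH (j + 1) = P.shiftSigH j
    + P.q j * P.L j * P.s (j + 1) * P.q j * P.s (j + 1)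
    + P.s (j + 1) * P.q j * P.L j * P.s (j + 1) * P.q j
    - P.q j * P.L j * P.s j * P.q (j + 1) * P.p (j + 1) * P.q j
    - P.s (j + 1) * P.q j * P.p (j + 1) * P.q (j + 1) * P.s j * P.L j * P.q j * P.s (j + 1) := by
  obtain ⟨n, rfl⟩ : ∃ n, j = n + 1 := ⟨j - 1, by omega⟩
  rfl

theorem sig_succ (j : ℕ) (hj : 1 ≤ j) (hk : j ≤ k - 1) : P.sig (j + 1) = P.s j * P.sigH j := by
  induction j, hj using Nat.le_induction with
  | base => simp [sig, LS, sigH_one]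
  | succ j hj ih =>
    have ih := ih (by omega)
    have e : P.sig (j + 1 + 1) = P.s j * P.s (j + 1) * P.sig (j + 1) * P.s (j + 1) * P.s j
        + P.s (j + 1) * P.q j * P.L j * P.s (j + 1) * P.q j * P.s (j + 1)
        + P.q j * P.L j * P.s (j + 1) * P.q j
        - P.s (j + 1) * P.q j * P.L j * P.s j * P.q (j + 1) * P.p (j + 1) * P.q j
        - P.q j * P.p (j + 1) * P.q (j + 1) * P.s j * P.L j * P.q j * P.s (j + 1) := by
      rw [show P.sig (j + 1 + 1) = (P.LS (j + 2)).2 from rfl, LS]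
      simp only [show j ≠ 0 by omega, if_false]
      rfl
    have s1 := P.s_sq (j + 1) (by omega) (by omega)
    have hb := P.braid j hj (by omega)
    have hs (x : A) : P.s (j + 1) * (P.s (j + 1) * x) = x := by rw [← mul_assoc, s1, one_mul]
    have hbr (x : A) : P.s j * (P.s (j + 1) * (P.s j * x))
        = P.s (j + 1) * (P.s j * (P.s (j + 1) * x)) := by
      simp only [← mul_assoc, hb]
    rw [e, ih, P.sigH_succ j hj, shiftSigH]
    simp only [mul_add, mul_sub, mul_assoc, hs, hbr]

theorem L_succ (j : ℕ) (hj : 1 ≤ j) (hk : j ≤ k - 1) : P.L (j + 1) =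
    -(P.s j * P.L j * P.q j) - P.q j * P.L j * P.s j + P.q j * P.L j * P.p (j + 1) * P.q j
      + P.s j * P.L j * P.s j + P.s j * P.sigH j := by
  rw [← P.sig_succ j hj hk]
  obtain ⟨n, rfl⟩ : ∃ n, j = n + 1 := ⟨j - 1, by omega⟩
  rfl

theorem commute_L_and_sigH (j : ℕ) (hj : 1 ≤ j) (hk : j ≤ k) :
    (∀ a : A, (∀ m, 1 ≤ m → m ≤ j → Commute a (P.p m)) →
      (∀ m, 1 ≤ m → m < j → Commute a (P.q m)) →
      (∀ m, 1 ≤ m → m < j → Commute a (P.s m)) → Commute a (P.L j)) ∧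
    (∀ a : A, (∀ m, 1 ≤ m → m ≤ j → Commute a (P.p m)) →
      (∀ m, 1 ≤ m → m ≤ j → Commute a (P.q m)) →
      (∀ m, 1 ≤ m → m ≤ j → Commute a (P.s m)) → Commute a (P.sigH j)) := by
  induction j, hj using Nat.le_induction with
  | base => exact ⟨fun a hp _ _ => P.L_one ▸ hp 1 le_rfl le_rfl,
      fun a _ _ _ => P.sigH_one ▸ Commute.one_right a⟩
  | succ j hj ih =>
    obtain ⟨ihL, ihσ⟩ := ih (by omega)
    constructor <;> intro a hp hq hs
    · have L := ihL a (fun m h h' => hp m h (by omega)) (fun m h h' => hq m h (by omega))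
        (fun m h h' => hs m h (by omega))
      have σ := ihσ a (fun m h h' => hp m h (by omega)) (fun m h h' => hq m h (by omega))
        (fun m h h' => hs m h (by omega))
      have s := hs j hj (by omega)
      have q := hq j hj (by omega)
      have p := hp (j + 1) (by omega) le_rfl
      rw [P.L_succ j hj (by omega)]
      exact ((((((s.mul_right L).mul_right q).neg_right.sub_right
        ((q.mul_right L).mul_right s)).add_right
        (((q.mul_right L).mul_right p).mul_right q))).add_right
        ((s.mul_right L).mul_right s)).add_right (s.mul_right σ)
    · have L := ihL a (fun m h h' => hp m h (by omega)) (fun m h h' => hq m h (by omega))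
        (fun m h h' => hs m h (by omega))
      have σ := ihσ a (fun m h h' => hp m h (by omega)) (fun m h h' => hq m h (by omega))
        (fun m h h' => hs m h (by omega))
      have s := hs j hj (by omega)
      have s' := hs (j + 1) (by omega) le_rfl
      have q := hq j hj (by omega)
      have q' := hq (j + 1) (by omega) le_rfl
      have p := hp (j + 1) (by omega) le_rfl
      rw [P.sigH_succ j hj, shiftSigH]
      refine ((((?_ : Commute _ _).add_right ?_).add_right ?_).sub_right ?_).sub_right ?_ <;>
      repeat' first
        | assumption
        | apply Commute.mul_right

section Generators

variable {j : ℕ}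

theorem r_eq (hj : 1 ≤ j) (hk : j + 1 ≤ k - 1) : P.r j = P.s j * P.q (j + 1) * P.s j :=
  P.sqs (j + 1) (by omega) hk

theorem q_mul_r (hj : 1 ≤ j) (hk : j + 1 ≤ k - 1) : P.q j * P.r j = P.q j * P.q (j + 1) := by
  have h1 := P.q_s j hj (by omega)
  have h2 := P.q_comm j (j + 1) hj (by omega) (by omega) (by omega)
  rw [P.r_eq hj hk, ← mul_assoc, ← mul_assoc, h1, h2, mul_assoc, h1]

theorem r_mul_q (hj : 1 ≤ j) (hk : j + 1 ≤ k - 1) : P.r j * P.q j = P.q j * P.q (j + 1) := by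
  have h1 := P.s_q j hj (by omega)
  have h2 := P.q_comm j (j + 1) hj (by omega) (by omega) (by omega)
  rw [P.r_eq hj hk, mul_assoc, h1, mul_assoc, ← h2, ← mul_assoc, h1]

theorem q_succ_mul_r (hj : 1 ≤ j) (hk : j + 1 ≤ k - 1) :
    P.q (j + 1) * P.r j = P.q j * P.q (j + 1) := by
  have h1 := P.q_s (j + 1) (by omega) hk
  have h2 := P.q_comm j (j + 1) hj (by omega) (by omega) (by omega)
  rw [r, ← mul_assoc, ← mul_assoc, h1, ← h2, mul_assoc, h1]

theorem r_mul_q_succ (hj : 1 ≤ j) (hk : j + 1 ≤ k - 1) :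
    P.r j * P.q (j + 1) = P.q j * P.q (j + 1) := by
  have h1 := P.s_q (j + 1) (by omega) hk
  have h2 := P.q_comm j (j + 1) hj (by omega) (by omega) (by omega)
  rw [r, mul_assoc, h1, mul_assoc, h2, ← mul_assoc, h1]

theorem r_sq (hj : 1 ≤ j) (hk : j + 1 ≤ k - 1) : P.r j * P.r j = P.r j := by
  have h1 := P.s_sq (j + 1) (by omega) hk
  have h2 := P.q_sq j hj (by omega)
  unfold r; grind

theorem p_r_p (hj : 1 ≤ j) (hk : j + 1 ≤ k - 1) : P.p j * P.r j * P.p j = P.p j := by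
  have h1 := P.s_sq (j + 1) (by omega) hk
  have h2 := P.pqp₂ j hj (by omega)
  have h3 := P.s_p (j + 1) j (by omega) hk hj (by omega) (by omega) (by omega)
  unfold r; grind

theorem r_p_r (hj : 1 ≤ j) (hk : j + 1 ≤ k - 1) : P.r j * P.p j * P.r j = P.r j := by
  have h1 := P.s_sq (j + 1) (by omega) hk
  have h2 := P.qpq₁ j hj (by omega)
  have h3 := P.s_p (j + 1) j (by omega) hk hj (by omega) (by omega) (by omega)
  unfold r; grind

end Generators

section Far

variable {j m : ℕ}

theorem commute_L_s (hj : 1 ≤ j) (hm : j < m) (hk : m ≤ k - 1) : Commute (P.L j) (P.s m) :=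
  ((P.commute_L_and_sigH j hj (by omega)).1 _
    (fun i _ _ => P.s_p m i (by omega) hk (by omega) (by omega) (by omega) (by omega))
    (fun i _ _ => P.s_q' m i (by omega) (by omega) (by omega) (by omega) (by omega) (by omega))
    (fun i _ _ => P.s_comm m i (by omega) (by omega) (by omega) (by omega) (by omega)
      (by omega))).symm

theorem commute_sigH_p (hj : 1 ≤ j) (hm : j + 1 < m) (hk : m ≤ k) :
    Commute (P.sigH j) (P.p m) :=
  ((P.commute_L_and_sigH j hj (by omega)).2 _
    (fun i _ _ => P.p_comm m i (by omega) hk (by omega) (by omega))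
    (fun i _ _ => (P.q_p i m (by omega) (by omega) (by omega) hk (by omega) (by omega)).symm)
    (fun i _ _ => (P.s_p i m (by omega) (by omega) (by omega) hk (by omega) (by omega)).symm)).symm

theorem commute_sigH_q (hj : 1 ≤ j) (hm : j + 1 < m) (hk : m ≤ k - 1) :
    Commute (P.sigH j) (P.q m) :=
  ((P.commute_L_and_sigH j hj (by omega)).2 _
    (fun i _ _ => P.q_p m i (by omega) hk (by omega) (by omega) (by omega) (by omega))
    (fun i _ _ => P.q_comm m i (by omega) hk (by omega) (by omega))
    (fun i _ _ => (P.s_q' i m (by omega) (by omega) (by omega) (by omega) (by omega)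
      (by omega)).symm)).symm

theorem commute_sigH_s (hj : 1 ≤ j) (hm : j + 1 < m) (hk : m ≤ k - 1) :
    Commute (P.sigH j) (P.s m) :=
  ((P.commute_L_and_sigH j hj (by omega)).2 _
    (fun i _ _ => P.s_p m i (by omega) hk (by omega) (by omega) (by omega) (by omega))
    (fun i _ _ => P.s_q' m i (by omega) (by omega) (by omega) (by omega) (by omega) (by omega))
    (fun i _ _ => P.s_comm m i (by omega) (by omega) (by omega) (by omega) (by omega)
      (by omega))).symm

end Far

/-- The symmetries of `σ_{j+1/2}` and the formula for `L_j` between two identifications that are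
propagated from `j` to `j + 1`. -/
structure Good (j : ℕ) : Prop where
  commute_s : Commute (P.sigH j) (P.s j)
  commute_q : Commute (P.sigH j) (P.q (j + 1))
  q_L_r : P.q j * P.L j * P.r j = P.shiftSigH j * (P.q j * P.p j * P.r j)

section Step

variable {P} {j : ℕ}

theorem shiftSigH_eq (P : PartitionAlgebra k A) (j : ℕ) : P.shiftSigH j =
    P.s j * P.s (j + 1) * P.sigH j * (P.s (j + 1) * P.s j) := by
  rw [shiftSigH, mul_assoc _ (P.s (j + 1)) (P.s j)]

theorem s_mul_s_inv (P : PartitionAlgebra k A) {i j : ℕ} (hi : 1 ≤ i) (hik : i ≤ k - 1)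
    (hj : 1 ≤ j) (hjk : j ≤ k - 1) : P.s i * P.s j * (P.s j * P.s i) = 1 := by
  rw [mul_assoc, ← mul_assoc (P.s j), P.s_sq j hj hjk, one_mul, P.s_sq i hi hik]

theorem commute_shiftSigH (P : PartitionAlgebra k A) (hj : 1 ≤ j) (hk : j + 1 ≤ k - 1) {z z' : A}
    (hz : z * (P.s j * P.s (j + 1)) = P.s j * P.s (j + 1) * z') (h : Commute (P.sigH j) z') :
    Commute (P.shiftSigH j) z := by
  rw [shiftSigH_eq]
  exact commute_conj (P.s_mul_s_inv hj (by omega) (by omega) hk)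
    (P.s_mul_s_inv (by omega) hk hj (by omega)) hz h

theorem p_mul_s (P : PartitionAlgebra k A) (hj : 1 ≤ j) (hk : j ≤ k - 1) :
    P.p j * P.s j = P.s j * P.p (j + 1) := by
  rw [← P.sps j hj hk, ← mul_assoc, ← mul_assoc, P.s_sq j hj hk, one_mul]

theorem p_succ_mul_s (P : PartitionAlgebra k A) (hj : 1 ≤ j) (hk : j ≤ k - 1) :
    P.p (j + 1) * P.s j = P.s j * P.p j := by
  rw [← P.sps j hj hk, mul_assoc, P.s_sq j hj hk, mul_one]

theorem commute_shiftSigH_p (P : PartitionAlgebra k A) (hj : 1 ≤ j) (hk : j + 1 ≤ k - 1) :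
    Commute (P.shiftSigH j) (P.p j) := by
  refine P.commute_shiftSigH hj hk ?_ (P.commute_sigH_p hj (by omega : j + 1 < j + 2) (by omega))
  rw [← mul_assoc, P.p_mul_s hj (by omega), mul_assoc, P.p_mul_s (by omega) hk, ← mul_assoc]

theorem s_mul_r (P : PartitionAlgebra k A) (hj : 1 ≤ j) (hk : j + 1 ≤ k - 1) :
    P.s (j + 1) * P.r j = P.q j * P.s (j + 1) := by
  rw [r, ← mul_assoc, ← mul_assoc, P.s_sq (j + 1) (by omega) hk, one_mul]

theorem r_mul_s (P : PartitionAlgebra k A) (hj : 1 ≤ j) (hk : j + 1 ≤ k - 1) :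
    P.r j * P.s (j + 1) = P.s (j + 1) * P.q j := by
  rw [r, mul_assoc, P.s_sq (j + 1) (by omega) hk, mul_one]

theorem r_mul_s' (P : PartitionAlgebra k A) (hj : 1 ≤ j) (hk : j + 1 ≤ k - 1) :
    P.r j * P.s j = P.s j * P.q (j + 1) := by
  rw [P.r_eq hj hk, mul_assoc, P.s_sq j (by omega) (by omega), mul_one]

theorem commute_r_p_succ (P : PartitionAlgebra k A) (hj : 1 ≤ j) (hk : j + 1 ≤ k - 1) :
    Commute (P.r j) (P.p (j + 1)) := by
  rw [Commute, SemiconjBy, P.r_eq hj hk, mul_assoc, ← P.p_mul_s hj (by omega), ← mul_assoc,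
    mul_assoc _ (P.q (j + 1)), P.q_p (j + 1) j (by omega) hk hj (by omega) (by omega) (by omega),
    ← mul_assoc, ← mul_assoc, ← mul_assoc, ← P.p_succ_mul_s hj (by omega)]

theorem commute_s_tau (P : PartitionAlgebra k A) (hj : 1 ≤ j) (hk : j + 1 ≤ k - 1) :
    Commute (P.s (j + 1)) (P.tau j) := by
  have h1 := P.s_sq (j + 1) (by omega) hk
  have h2 : P.s (j + 1) * P.p j * P.s (j + 1) = P.p j := by
    rw [P.s_p (j + 1) j (by omega) hk hj (by omega) (by omega) (by omega), mul_assoc, h1, mul_one]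
  have h3 : P.s (j + 1) * P.r j * P.s (j + 1) = P.q j := by
    rw [P.s_mul_r hj hk, mul_assoc, h1, mul_one]
  have h := mul_swap_mul (p := P.p j) (x := P.q j) (y := P.r j) h1 h1
  rw [h2, h3, ← r, swap_symm (P.p j) (P.r j)] at h
  rw [Commute, SemiconjBy, tau, ← mul_one (_ * swap _ _ _), ← h1, ← mul_assoc, h]

theorem Good.commute_r (h : P.Good j) (hj : 1 ≤ j) (hk : j + 1 ≤ k - 1) :
    Commute (P.sigH j) (P.r j) := by
  rw [P.r_eq hj hk]
  exact (h.commute_s.mul_right h.commute_q).mul_right h.commute_s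

theorem Good.commute_shift_s (h : P.Good j) (hj : 1 ≤ j) (hk : j + 1 ≤ k - 1) :
    Commute (P.shiftSigH j) (P.s (j + 1)) :=
  P.commute_shiftSigH hj hk (by rw [← mul_assoc, P.braid j hj hk]) h.commute_s

theorem Good.commute_shift_q (h : P.Good j) (hj : 1 ≤ j) (hk : j + 1 ≤ k - 1) :
    Commute (P.shiftSigH j) (P.q j) :=
  P.commute_shiftSigH hj hk (by
    rw [← mul_assoc, P.q_s j hj (by omega), mul_assoc, P.s_mul_r hj hk, ← mul_assoc,
      P.s_q j hj (by omega)]) (h.commute_r hj hk)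

theorem Good.r_L_q (h : P.Good j) (hj : 1 ≤ j) (hk : j + 1 ≤ k - 1) :
    P.r j * P.L j * P.q j = P.shiftSigH j * (P.r j * P.p j * P.q j) := by
  have h1 := P.s_sq (j + 1) (by omega) hk
  have hL := P.commute_L_s hj (by omega : j < j + 1) hk
  have hp := P.s_p (j + 1) j (by omega) hk hj (by omega) (by omega) (by omega)
  have hC := h.commute_shift_s hj hk
  have hr' := P.r_mul_s hj hk
  have hA := h.q_L_r
  calc P.r j * P.L j * P.q j
      = P.s (j + 1) * P.q j * (P.s (j + 1) * P.L j) * P.q j := by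
        rw [r]; simp only [mul_assoc]
    _ = P.s (j + 1) * (P.q j * P.L j * P.r j) * P.s (j + 1) := by
        rw [← hL.eq]; simp only [mul_assoc, hr']
    _ = P.shiftSigH j * (P.s (j + 1) * P.q j * P.p j * (P.r j * P.s (j + 1))) := by
        rw [hA, ← mul_assoc, ← hC.eq]; simp only [mul_assoc]
    _ = P.shiftSigH j * (P.r j * (P.s (j + 1) * P.p j) * (P.r j * P.s (j + 1))) := by
        rw [← hr']; simp only [mul_assoc]
    _ = P.shiftSigH j * (P.r j * P.p j * (P.s (j + 1) * P.s (j + 1)) * P.q j) := by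
        rw [hp, hr']; simp only [mul_assoc]
    _ = _ := by rw [h1, mul_one]

theorem s_q_p_q (P : PartitionAlgebra k A) (hj : 1 ≤ j) (hk : j + 1 ≤ k - 1) :
    P.s j * P.q (j + 1) * P.p (j + 1) * P.q j = P.r j * P.p j * P.q j := by
  rw [← P.r_mul_s' hj hk, mul_assoc (P.r j), ← P.p_mul_s hj (by omega)]
  simp only [mul_assoc, P.s_q j hj (by omega : j ≤ k - 1)]

theorem q_p_q_s (P : PartitionAlgebra k A) (hj : 1 ≤ j) (hk : j + 1 ≤ k - 1) :
    P.q j * P.p (j + 1) * P.q (j + 1) * P.s j = P.q j * P.p j * P.r j := by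
  rw [P.r_eq hj hk, ← mul_assoc, ← mul_assoc, mul_assoc (P.q j) (P.p j), P.p_mul_s hj (by omega),
    ← mul_assoc, P.q_s j hj (by omega)]

theorem Good.sigH_succ_eq (h : P.Good j) (hj : 1 ≤ j) (hk : j + 1 ≤ k - 1) :
    P.sigH (j + 1) = P.shiftSigH j * P.tau j := by
  have hL := P.commute_L_s hj (by omega : j < j + 1) hk
  have hA := h.q_L_r
  have hA' := h.r_L_q hj hk
  have hr' := P.r_mul_s hj hk
  have e2 : P.q j * P.L j * P.s (j + 1) * P.q j * P.s (j + 1) =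
      P.shiftSigH j * (P.q j * P.p j * P.r j) := by
    rw [← hA, r]; simp only [mul_assoc]
  have e3 : P.s (j + 1) * P.q j * P.L j * P.s (j + 1) * P.q j =
      P.shiftSigH j * (P.r j * P.p j * P.q j) := by
    rw [← hA', r, mul_assoc _ (P.L j), hL.eq]; simp only [mul_assoc]
  have hxyx : P.q j * P.p j * P.r j * P.p j * P.q j = P.q j := by
    rw [mul_assoc (P.q j), mul_assoc (P.q j), P.p_r_p hj hk, P.qpq₁ j hj (by omega)]
  have e4 : P.q j * P.L j * P.s j * P.q (j + 1) * P.p (j + 1) * P.q j =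
      P.shiftSigH j * P.q j := by
    calc _ = P.q j * P.L j * (P.s j * P.q (j + 1) * P.p (j + 1) * P.q j) := by
          simp only [mul_assoc]
      _ = P.q j * P.L j * P.r j * P.p j * P.q j := by
          rw [P.s_q_p_q hj hk]; simp only [mul_assoc]
      _ = P.shiftSigH j * (P.q j * P.p j * P.r j * P.p j * P.q j) := by
          rw [hA]; simp only [mul_assoc]
      _ = _ := by rw [hxyx]
  have e5 : P.s (j + 1) * P.q j * P.p (j + 1) * P.q (j + 1) * P.s j * P.L j * P.q j * P.s (j + 1) =
      P.shiftSigH j * P.r j := by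
    calc _ = P.s (j + 1) * (P.q j * P.p (j + 1) * P.q (j + 1) * P.s j) * P.L j * P.q j
          * P.s (j + 1) := by simp only [mul_assoc]
      _ = P.s (j + 1) * (P.q j * P.p j * (P.r j * P.L j * P.q j)) * P.s (j + 1) := by
          rw [P.q_p_q_s hj hk]; simp only [mul_assoc]
      _ = P.s (j + 1) * (P.q j * (P.p j * P.shiftSigH j) * (P.r j * P.p j * P.q j))
          * P.s (j + 1) := by
          rw [hA']; simp only [mul_assoc]
      _ = P.s (j + 1) * (P.q j * P.shiftSigH j * P.p j * (P.r j * P.p j * P.q j))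
          * P.s (j + 1) := by
          rw [← (P.commute_shiftSigH_p hj hk).eq]; simp only [mul_assoc]
      _ = P.s (j + 1) * P.shiftSigH j * (P.q j * P.p j * P.r j * P.p j * P.q j)
          * P.s (j + 1) := by
          rw [← (h.commute_shift_q hj hk).eq]; simp only [mul_assoc]
      _ = _ := by rw [hxyx, ← (h.commute_shift_s hj hk).eq, r]; simp only [mul_assoc]
  rw [P.sigH_succ j hj, e2, e3, e4, e5, tau, swap]
  simp only [mul_add, mul_sub, mul_one]
  abel

end Step

section Terms

variable {M : Type*} [Monoid M] {s q x y X Y p p' L D : M}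

theorem term_one (hsx : X * s = s * x) (hsy : s * y = Y * s) (hsp : s * p = p' * s)
    (hsq : s * q = q) (hqY : q * Y = y * q) (hyY : y * Y = Y * q) (hyX : y * X = X * y)
    (hyp : y * p' = p' * y) (hDs : D * s = s * D) (hL : x * L * y = D * (x * p * y)) :
    X * (s * L * q) * Y = D * (y * X * p' * Y) := by
  calc X * (s * L * q) * Y = X * s * L * (q * Y) := by simp only [mul_assoc]
    _ = s * (x * L * y) * q := by rw [hsx, hqY]; simp only [mul_assoc]
    _ = D * ((s * x) * p * y * q) := by rw [hL, ← mul_assoc, ← hDs]; simp only [mul_assoc]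
    _ = D * (X * (s * p) * y * q) := by rw [← hsx]; simp only [mul_assoc]
    _ = D * (X * p' * (s * y) * q) := by rw [hsp]; simp only [mul_assoc]
    _ = D * (X * p' * Y * q) := by rw [hsy]; simp only [mul_assoc, hsq]
    _ = D * (y * X * p' * Y) := by
      rw [hyX, mul_assoc X y, hyp]; simp only [mul_assoc, hyY]

theorem term_two (hsY : s * Y = y * s) (hsx : X * s = s * x) (hsy : s * y = Y * s)
    (hsp : s * p = p' * s) (hss : s * s = 1) (hqs : q * s = q) (hXq : X * q = q * x)
    (hqX : q * X = x * X) (hDq : D * q = q * D)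
    (hL : x * L * y = D * (x * p * y)) :
    X * (q * L * s) * Y = D * (x * X * p' * Y) := by
  calc X * (q * L * s) * Y = X * q * L * (s * Y) := by simp only [mul_assoc]
    _ = q * (x * L * y) * s := by rw [hXq, hsY]; simp only [mul_assoc]
    _ = D * (q * x * p * y * s) := by rw [hL, ← mul_assoc, ← hDq]; simp only [mul_assoc]
    _ = D * (q * s * x * p * y * s) := by rw [hqs]
    _ = D * (q * X * (s * p) * y * s) := by rw [mul_assoc q, ← hsx]; simp only [mul_assoc]
    _ = D * (x * X * p' * (s * y * s)) := by rw [hsp, hqX]; simp only [mul_assoc]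
    _ = D * (x * X * p' * Y) := by rw [hsy, mul_assoc Y, hss, mul_one]

theorem term_three (hXq : X * q = q * x) (hqY : q * Y = y * q) (hqx : q * x = x * X)
    (hyY : y * Y = y * q) (hyX : y * X = X * y)
    (hyp : y * p' = p' * y) (hpX : p * X = X * p)
    (hDq : D * q = q * D)
    (hL : x * L * y = D * (x * p * y)) :
    X * (q * L * p' * q) * Y = D * (x * p * y * X * p' * Y) := by
  calc X * (q * L * p' * q) * Y = X * q * L * p' * (q * Y) := by simp only [mul_assoc]
    _ = q * x * L * (p' * y) * q := by rw [hXq, hqY]; simp only [mul_assoc]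
    _ = q * (x * L * y) * p' * q := by rw [← hyp]; simp only [mul_assoc]
    _ = D * (q * x * p * (y * p') * q) := by
      rw [hL, ← mul_assoc, ← hDq]; simp only [mul_assoc]
    _ = D * (x * (X * p) * p' * (y * q)) := by rw [hqx, hyp]; simp only [mul_assoc]
    _ = D * (x * p * X * (p' * y) * Y) := by rw [← hpX, ← hyY]; simp only [mul_assoc]
    _ = D * (x * p * (X * y) * p' * Y) := by rw [← hyp]; simp only [mul_assoc]
    _ = _ := by rw [← hyX]; simp only [mul_assoc]

theorem term_four (hsx : X * s = s * x) (hsY : s * Y = y * s) (hsy : s * y = Y * s)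
    (hsp : s * p = p' * s) (hss : s * s = 1) (hDs : D * s = s * D)
    (hL : x * L * y = D * (x * p * y)) :
    X * (s * L * s) * Y = D * (X * p' * Y) := by
  calc X * (s * L * s) * Y = X * s * L * (s * Y) := by simp only [mul_assoc]
    _ = s * (x * L * y) * s := by rw [hsx, hsY]; simp only [mul_assoc]
    _ = D * ((s * x) * p * y * s) := by rw [hL, ← mul_assoc, ← hDs]; simp only [mul_assoc]
    _ = D * (X * (s * p) * y * s) := by rw [← hsx]; simp only [mul_assoc]
    _ = D * (X * p' * (s * y) * s) := by rw [hsp]; simp only [mul_assoc]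
    _ = D * (X * p' * Y) := by rw [hsy, mul_assoc, mul_assoc Y, hss, mul_one]

theorem term_five {σ : M} (hsx : X * s = s * x) (hsy : s * y = Y * s)
    (hss : s * s = 1)
    (hspp : s * (p * p') = p * p') (hxY : x * Y = Y * x) (hxp' : x * p' = p' * x)
    (hpY : p * Y = Y * p) (hpX : p * X = X * p) (hxX : x * X = X * x)
    (hxpx : x * p * x = x) (hYpY : Y * p' * Y = Y)
    (hDs : D * s = s * D) (hσ : σ * Y = Y * σ) (hxYσ : x * Y * σ = D * (x * Y)) :
    X * (s * σ) * Y = D * (y * p * x * X * p' * Y) := by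
  have hsX : s * X = x * s := by
    rw [← mul_one (s * X), ← hss, ← mul_assoc, mul_assoc s X, hsx, ← mul_assoc, hss, one_mul]
  have h1 : s * (y * p * x * X * p' * Y) = x * Y := by
    calc s * (y * p * x * X * p' * Y) = s * y * p * (x * X) * p' * Y := by simp only [mul_assoc]
      _ = Y * s * (p * X) * (x * p') * Y := by rw [hsy, hxX]; simp only [mul_assoc]
      _ = Y * (s * X) * (p * p') * (x * Y) := by rw [hpX, hxp']; simp only [mul_assoc]
      _ = Y * x * (s * (p * p')) * (x * Y) := by rw [hsX]; simp only [mul_assoc]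
      _ = x * (Y * p) * (p' * x) * Y := by rw [hspp, ← hxY]; simp only [mul_assoc]
      _ = x * p * (Y * x) * p' * Y := by rw [← hpY, ← hxp']; simp only [mul_assoc]
      _ = x * p * x * (Y * p' * Y) := by rw [← hxY]; simp only [mul_assoc]
      _ = x * Y := by rw [hxpx, hYpY]
  calc X * (s * σ) * Y = X * s * (σ * Y) := by simp only [mul_assoc]
    _ = s * (x * Y * σ) := by rw [hsx, hσ]; simp only [mul_assoc]
    _ = D * (s * (s * (y * p * x * X * p' * Y))) := by
      rw [hxYσ, ← mul_assoc, ← hDs, mul_assoc, h1]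
    _ = _ := by rw [← mul_assoc s, hss, one_mul]

end Terms

/-- The element identifying positions `j` and `j + 3`. -/
def u (j : ℕ) : A := P.s (j + 1 + 1) * P.r j * P.s (j + 1 + 1)

/-- The shift of `σ_{j+1/2}` by two steps on the positions `j` and `j + 1`. -/
def shiftSigHTwo (j : ℕ) : A :=
  P.s (j + 1) * P.s (j + 1 + 1) * P.shiftSigH j * (P.s (j + 1 + 1) * P.s (j + 1))

section Local

variable {P} {j : ℕ}

theorem q_succ_mul_s (P : PartitionAlgebra k A) (hj : 1 ≤ j) (hk : j + 1 ≤ k - 1) :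
    P.q (j + 1) * P.s j = P.s j * P.r j := by
  rw [P.r_eq hj hk, ← mul_assoc, ← mul_assoc, P.s_sq j hj (by omega), one_mul]

theorem q_mul_s_mul_s (P : PartitionAlgebra k A) (hj : 1 ≤ j) (hk : j + 1 ≤ k - 1) :
    P.q j * (P.s (j + 1) * P.s j) = P.s (j + 1) * P.s j * P.q (j + 1) := by
  rw [mul_assoc (P.s (j + 1)), ← P.r_mul_s' hj hk, ← mul_assoc, ← mul_assoc, P.s_mul_r hj hk]

variable (P) (hj : 1 ≤ j) (hk : j + 1 + 1 ≤ k - 1)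
include hj hk

theorem s_comm_two : P.s j * P.s (j + 1 + 1) = P.s (j + 1 + 1) * P.s j :=
  P.s_comm j (j + 1 + 1) hj (by omega) (by omega) hk (by omega) (by omega)

theorem s_q_two : P.s (j + 1 + 1) * P.q j = P.q j * P.s (j + 1 + 1) :=
  P.s_q' (j + 1 + 1) j (by omega) hk hj (by omega) (by omega) (by omega)

theorem s_p_two : P.s (j + 1 + 1) * P.p j = P.p j * P.s (j + 1 + 1) :=
  P.s_p (j + 1 + 1) j (by omega) hk hj (by omega) (by omega) (by omega)

theorem u_eq : P.u j = P.s j * P.r (j + 1) * P.s j := by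
  have h := P.s_comm_two hj hk
  rw [u, P.r_eq hj (by omega), r.eq_def P (j + 1)]
  grind

theorem s_mul_u : P.s j * P.u j = P.r (j + 1) * P.s j := by
  rw [P.u_eq hj hk, ← mul_assoc, ← mul_assoc, P.s_sq j hj (by omega), one_mul]

theorem s_mul_r_succ : P.s j * P.r (j + 1) = P.u j * P.s j := by
  rw [P.u_eq hj hk, mul_assoc, P.s_sq j hj (by omega), mul_one]

theorem u_mul_q : P.u j * P.q j = P.q j * P.r (j + 1) := by
  have h1 := P.s_q_two hj hk
  have h2 := P.r_mul_q hj (by omega)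
  rw [u, r.eq_def P (j + 1), mul_assoc, h1, ← mul_assoc, mul_assoc _ (P.r j), h2]
  simp only [← mul_assoc, h1]

theorem q_mul_u : P.q j * P.u j = P.q j * P.r (j + 1) := by
  have h1 := P.s_q_two hj hk
  have h2 := P.q_mul_r hj (by omega)
  rw [u, r.eq_def P (j + 1)]
  grind

theorem r_succ_mul_q : P.r (j + 1) * P.q j = P.q j * P.r (j + 1) := by
  have h1 := P.s_q_two hj hk
  have h2 := P.q_comm j (j + 1) hj (by omega) (by omega) (by omega)
  rw [r.eq_def P (j + 1), mul_assoc, h1, ← mul_assoc, mul_assoc _ (P.q (j + 1)), ← h2]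
  simp only [← mul_assoc, h1]

theorem u_mul_r_succ : P.u j * P.r (j + 1) = P.q j * P.r (j + 1) := by
  have h1 := P.s_q_two hj hk
  have h2 := P.r_mul_q_succ hj (by omega)
  have h3 := P.s_sq (j + 1 + 1) (by omega) hk
  rw [u, r.eq_def P (j + 1)]
  grind

theorem r_succ_mul_u : P.r (j + 1) * P.u j = P.q j * P.r (j + 1) := by
  have h1 := P.s_q_two hj hk
  have h2 := P.q_succ_mul_r hj (by omega)
  have h3 := P.s_sq (j + 1 + 1) (by omega) hk
  rw [u, r.eq_def P (j + 1)]
  grind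

theorem r_mul_r_succ : P.r j * P.r (j + 1) = P.r (j + 1) * P.r j := by
  have h1 := P.s_sq (j + 1) (by omega) (by omega)
  have h2 := P.q_comm j (j + 1 + 1) hj (by omega) (by omega) hk
  rw [P.r_eq (j := j + 1) (by omega) hk, r]
  grind

theorem u_mul_q_succ : P.u j * P.q (j + 1) = P.q (j + 1) * P.u j := by
  have h1 := P.r_mul_r_succ hj hk
  have h2 := P.r_mul_s' hj (by omega)
  have h3 := P.q_succ_mul_s hj (by omega)
  rw [P.u_eq hj hk]
  calc P.s j * P.r (j + 1) * P.s j * P.q (j + 1)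
      = P.s j * (P.r (j + 1) * P.r j) * P.s j := by rw [mul_assoc, ← h2]; simp only [mul_assoc]
    _ = P.q (j + 1) * (P.s j * P.r (j + 1) * P.s j) := by
      rw [← h1]; simp only [← mul_assoc]; rw [h3]

theorem u_mul_p_succ : P.u j * P.p (j + 1) = P.p (j + 1) * P.u j := by
  have h1 := P.s_p (j + 1 + 1) (j + 1) (by omega) hk (by omega) (by omega) (by omega) (by omega)
  have h2 := (P.commute_r_p_succ hj (by omega)).eq
  rw [u, mul_assoc, h1, ← mul_assoc, mul_assoc _ (P.r j), h2]
  simp only [← mul_assoc, h1]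

theorem p_mul_r_succ : P.p j * P.r (j + 1) = P.r (j + 1) * P.p j := by
  have h1 := P.s_p_two hj hk
  have h2 := P.q_p (j + 1) j (by omega) (by omega) hj (by omega) (by omega) (by omega)
  rw [r, mul_assoc _ _ (P.p j), h1, ← mul_assoc _ (P.p j),
    mul_assoc (P.s (j + 1 + 1)) (P.q (j + 1)) (P.p j), h2]
  simp only [← mul_assoc, h1]

theorem p_u_p : P.p j * P.u j * P.p j = P.p j := by
  have h1 := P.s_p_two hj hk
  have h2 := P.p_r_p hj (by omega)
  have h3 := P.s_sq (j + 1 + 1) (by omega) hk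
  rw [u]
  grind

end Local

section StepTwo

variable {j : ℕ} (hj : 1 ≤ j) (hk : j + 1 + 1 ≤ k - 1)
include hj hk

theorem shiftSigHTwo_eq : P.shiftSigHTwo j =
    P.s (j + 1) * P.s j * (P.s (j + 1 + 1) * P.s (j + 1)) * P.sigH j *
      (P.s (j + 1) * P.s (j + 1 + 1) * (P.s j * P.s (j + 1))) := by
  have h := P.s_comm_two hj hk
  calc P.shiftSigHTwo j
      = P.s (j + 1) * (P.s (j + 1 + 1) * P.s j) * P.s (j + 1) * P.sigH j * P.s (j + 1) *
        (P.s j * P.s (j + 1 + 1)) * P.s (j + 1) := by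
        rw [shiftSigHTwo, shiftSigH]; simp only [mul_assoc]
    _ = _ := by rw [← h]; nth_rw 2 [h]; simp only [mul_assoc]

theorem cycle_mul_inv : P.s (j + 1) * P.s j * (P.s (j + 1 + 1) * P.s (j + 1)) *
    (P.s (j + 1) * P.s (j + 1 + 1) * (P.s j * P.s (j + 1))) = 1 := by
  rw [mul_assoc, ← mul_assoc (P.s (j + 1 + 1) * P.s (j + 1)),
    P.s_mul_s_inv (by omega) hk (by omega) (by omega), one_mul,
    P.s_mul_s_inv (by omega) (by omega) hj (by omega)]

theorem inv_mul_cycle : P.s (j + 1) * P.s (j + 1 + 1) * (P.s j * P.s (j + 1)) *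
    (P.s (j + 1) * P.s j * (P.s (j + 1 + 1) * P.s (j + 1))) = 1 := by
  rw [mul_assoc, ← mul_assoc (P.s j * P.s (j + 1)),
    P.s_mul_s_inv hj (by omega) (by omega) (by omega), one_mul,
    P.s_mul_s_inv (by omega) (by omega) (by omega) hk]

theorem commute_shiftSigHTwo {z z' : A}
    (hz : z * (P.s (j + 1) * P.s j * (P.s (j + 1 + 1) * P.s (j + 1))) =
      P.s (j + 1) * P.s j * (P.s (j + 1 + 1) * P.s (j + 1)) * z')
    (h : Commute (P.sigH j) z') : Commute (P.shiftSigHTwo j) z := by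
  rw [P.shiftSigHTwo_eq hj hk]
  exact commute_conj (P.cycle_mul_inv hj hk) (P.inv_mul_cycle hj hk) hz h

theorem commute_shiftSigHTwo_s : Commute (P.shiftSigHTwo j) (P.s j) := by
  refine P.commute_shiftSigHTwo hj hk ?_
    (P.commute_sigH_s hj (by omega : j + 1 < j + 1 + 1) hk)
  have h1 := P.braid j hj (by omega)
  have h2 := P.braid (j + 1) (by omega) hk
  calc _ = P.s j * P.s (j + 1) * P.s j * P.s (j + 1 + 1) * P.s (j + 1) := by
        simp only [mul_assoc]
    _ = P.s (j + 1) * P.s j * (P.s (j + 1) * P.s (j + 1 + 1) * P.s (j + 1)) := by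
        rw [h1]; simp only [mul_assoc]
    _ = _ := by rw [h2]; simp only [mul_assoc]

theorem commute_shiftSigHTwo_q : Commute (P.shiftSigHTwo j) (P.q j) := by
  refine P.commute_shiftSigHTwo hj hk ?_
    (P.commute_sigH_q hj (by omega : j + 1 < j + 1 + 1) hk)
  rw [← mul_assoc, P.q_mul_s_mul_s hj (by omega), mul_assoc,
    P.q_mul_s_mul_s (by omega) hk, ← mul_assoc]

theorem commute_shiftSigHTwo_p : Commute (P.shiftSigHTwo j) (P.p j) := by
  refine P.commute_shiftSigHTwo hj hk ?_
    (P.commute_sigH_p hj (by omega : j + 1 < j + 1 + 1) (by omega))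
  have h1 := P.s_p (j + 1) j (by omega) (by omega) hj (by omega) (by omega) (by omega)
  have h2 := P.p_mul_s hj (by omega)
  have h3 := P.s_p (j + 1 + 1) (j + 1) (by omega) hk (by omega) (by omega) (by omega) (by omega)
  have h4 := P.p_mul_s (j := j + 1) (by omega) (by omega)
  calc _ = P.p j * P.s (j + 1) * P.s j * P.s (j + 1 + 1) * P.s (j + 1) := by
        simp only [mul_assoc]
    _ = P.s (j + 1) * (P.p j * P.s j) * P.s (j + 1 + 1) * P.s (j + 1) := by
        rw [← h1]; simp only [mul_assoc]
    _ = P.s (j + 1) * P.s j * (P.p (j + 1) * P.s (j + 1 + 1)) * P.s (j + 1) := by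
        rw [h2]; simp only [mul_assoc]
    _ = P.s (j + 1) * P.s j * P.s (j + 1 + 1) * (P.p (j + 1) * P.s (j + 1)) := by
        rw [← h3]; simp only [mul_assoc]
    _ = _ := by rw [h4]; simp only [mul_assoc]

theorem cycle_mul_r_mul_r : P.s (j + 1) * P.s j * (P.s (j + 1 + 1) * P.s (j + 1)) *
    (P.r j * P.r (j + 1)) = P.r j * P.r (j + 1) := by
  have h1 := P.s_mul_r hj (by omega)
  have h2 := P.s_mul_r (j := j + 1) (by omega) hk
  have h4 := P.r_mul_r_succ hj hk
  have h5 := P.s_q j hj (by omega)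
  have h6 := P.s_q (j + 1) (by omega) (by omega)
  have h7 := P.braid (j + 1) (by omega) hk
  have h8 := P.s_q_two hj hk
  calc _ = P.s (j + 1) * P.s j * P.s (j + 1 + 1) * (P.s (j + 1) * P.r j) * P.r (j + 1) := by
        simp only [mul_assoc]
    _ = P.s (j + 1) * P.s j * (P.s (j + 1 + 1) * P.q j) * P.s (j + 1) * P.r (j + 1) := by
        rw [h1]; simp only [mul_assoc]
    _ = P.s (j + 1) * (P.s j * P.q j) * P.s (j + 1 + 1) * P.s (j + 1) * P.r (j + 1) := by
        rw [h8]; simp only [mul_assoc]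
    _ = P.s (j + 1) * (P.s (j + 1 + 1) * P.q j) * P.s (j + 1) * P.r (j + 1) := by
        rw [h5, h8]; simp only [mul_assoc]
    _ = P.s (j + 1) * P.s (j + 1 + 1) * P.s (j + 1) * (P.r j * P.r (j + 1)) := by
        simp only [mul_assoc]
        rw [← mul_assoc (P.s (j + 1)) (P.r j), h1]
        simp only [mul_assoc]
    _ = P.s (j + 1 + 1) * P.s (j + 1) * (P.s (j + 1 + 1) * P.r (j + 1)) * P.r j := by
        rw [h7, h4]; simp only [mul_assoc]
    _ = P.s (j + 1 + 1) * (P.s (j + 1) * P.q (j + 1)) * P.s (j + 1 + 1) * P.r j := by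
        rw [h2]; simp only [mul_assoc]
    _ = P.r (j + 1) * P.r j := by rw [h6, r.eq_def P (j + 1)]
    _ = _ := h4.symm

end StepTwo

section GoodStep

variable {P} {j : ℕ} (h : P.Good j) (hj : 1 ≤ j) (hk : j + 1 + 1 ≤ k - 1)
include h hj hk

theorem Good.commute_r_succ : Commute (P.sigH j) (P.r (j + 1)) :=
  ((P.commute_sigH_s hj (by omega) hk).mul_right h.commute_q).mul_right
    (P.commute_sigH_s hj (by omega) hk)

theorem Good.r_r_sigH :
    P.r j * P.r (j + 1) * P.sigH j = P.shiftSigHTwo j * (P.r j * P.r (j + 1)) := by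
  have h1 := P.cycle_mul_r_mul_r hj hk
  have h2 := ((h.commute_r hj (by omega)).mul_right (h.commute_r_succ hj hk)).eq
  have h3 := P.inv_mul_cycle hj hk
  symm
  rw [← h1, P.shiftSigHTwo_eq hj hk, mul_assoc, ← mul_assoc _ _ (P.r j * P.r (j + 1)), h3, one_mul, mul_assoc, h2,
    ← mul_assoc, h1]

theorem Good.shiftSigH_succ_eq :
    P.shiftSigH (j + 1) = P.shiftSigHTwo j * swap (P.p j) (P.r j) (P.u j) := by
  have h1 := P.s_mul_s_inv (i := j + 1) (j := j + 1 + 1) (by omega) (by omega) (by omega) hk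
  have h2 := P.s_mul_s_inv (i := j + 1 + 1) (j := j + 1) (by omega) hk (by omega) (by omega)
  have b1 := P.s_sq (j + 1) (by omega) (by omega)
  have c1 := P.s_sq (j + 1 + 1) (by omega) hk
  have bp := P.s_p (j + 1) j (by omega) (by omega) hj (by omega) (by omega) (by omega)
  have cp := P.s_p_two hj hk
  have cq := P.s_q_two hj hk
  have br := P.braid (j + 1) (by omega) hk
  have hs := mul_swap_mul (p := P.p j) (x := P.q j) (y := P.r j) h2 h1
  have e1 : P.s (j + 1) * P.s (j + 1 + 1) * P.p j * (P.s (j + 1 + 1) * P.s (j + 1)) = P.p j := by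
    grind
  have e2 : P.s (j + 1) * P.s (j + 1 + 1) * P.q j * (P.s (j + 1 + 1) * P.s (j + 1)) = P.r j := by
    rw [r]; grind
  have e3 : P.s (j + 1) * P.s (j + 1 + 1) * P.r j * (P.s (j + 1 + 1) * P.s (j + 1)) = P.u j := by
    rw [u, r]
    calc _ = P.s (j + 1) * P.s (j + 1 + 1) * P.s (j + 1) * P.q j *
          (P.s (j + 1) * P.s (j + 1 + 1) * P.s (j + 1)) := by simp only [mul_assoc]
      _ = P.s (j + 1 + 1) * P.s (j + 1) * (P.s (j + 1 + 1) * P.q j) * P.s (j + 1 + 1)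
          * P.s (j + 1) * P.s (j + 1 + 1) := by rw [br]; simp only [mul_assoc]
      _ = P.s (j + 1 + 1) * P.s (j + 1) * P.q j * (P.s (j + 1 + 1) * P.s (j + 1 + 1))
          * P.s (j + 1) * P.s (j + 1 + 1) := by rw [cq]; simp only [mul_assoc]
      _ = _ := by rw [c1, mul_one]; simp only [mul_assoc]
  rw [e1, e2, e3] at hs
  rw [shiftSigH_eq, h.sigH_succ_eq hj (by omega), ← hs, shiftSigHTwo, tau, mul_assoc _ _
    (_ * swap _ _ _ * _), mul_assoc _ (swap _ _ _), ← mul_assoc _ _ (swap _ _ _ * _), h2, one_mul]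
  simp only [mul_assoc]

theorem Good.r_L_u :
    P.r j * P.L j * P.u j = P.shiftSigHTwo j * (P.r j * P.p j * P.u j) := by
  have b1 := P.s_sq (j + 1) (by omega) (by omega)
  have c1 := P.s_sq (j + 1 + 1) (by omega) hk
  have bp := P.s_p (j + 1) j (by omega) (by omega) hj (by omega) (by omega) (by omega)
  have cp := P.s_p_two hj hk
  have cq := P.s_q_two hj hk
  have bL := (P.commute_L_s hj (by omega : j < j + 1) (by omega)).eq
  have cL := (P.commute_L_s hj (by omega : j < j + 1 + 1) hk).eq
  have br := P.braid (j + 1) (by omega) hk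
  have key {z : A} (hb : z * P.s (j + 1) = P.s (j + 1) * z)
      (hc : z * P.s (j + 1 + 1) = P.s (j + 1 + 1) * z) :
      P.s (j + 1) * P.s (j + 1 + 1) * (P.q j * z * P.r j) * (P.s (j + 1 + 1) * P.s (j + 1))
        = P.r j * z * P.u j := by
    rw [u, r]
    calc _ = P.s (j + 1) * P.s (j + 1 + 1) * P.q j * (z * P.s (j + 1)) * P.q j *
          (P.s (j + 1) * P.s (j + 1 + 1) * P.s (j + 1)) := by simp only [mul_assoc]
      _ = P.s (j + 1) * P.s (j + 1 + 1) * P.q j * P.s (j + 1) * z * (P.q j *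
          P.s (j + 1 + 1)) * P.s (j + 1) * P.s (j + 1 + 1) := by
        rw [hb, br]; simp only [mul_assoc]
      _ = P.s (j + 1) * (P.s (j + 1 + 1) * P.q j) * P.s (j + 1) * (z * P.s (j + 1 + 1)) * P.q j *
          P.s (j + 1) * P.s (j + 1 + 1) := by
        rw [← cq]; simp only [mul_assoc]
      _ = P.s (j + 1) * P.q j * (P.s (j + 1 + 1) * P.s (j + 1) * P.s (j + 1 + 1)) * z * P.q j *
          P.s (j + 1) * P.s (j + 1 + 1) := by
        rw [hc, cq]; simp only [mul_assoc]
      _ = P.s (j + 1) * P.q j * P.s (j + 1) * P.s (j + 1 + 1) * (z * P.s (j + 1)) * P.q j *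
          P.s (j + 1) * P.s (j + 1 + 1) := by
        rw [← br, hb]; simp only [mul_assoc]
      _ = P.s (j + 1) * P.q j * P.s (j + 1) * (z * P.s (j + 1 + 1)) * P.s (j + 1) * P.q j *
          P.s (j + 1) * P.s (j + 1 + 1) := by
        rw [hc]; simp only [mul_assoc]
      _ = _ := by simp only [mul_assoc]
  rw [← key bL cL, ← key bp.symm cp.symm, h.q_L_r, shiftSigHTwo]
  have cancel (z : A) :
      P.s (j + 1 + 1) * (P.s (j + 1) * (P.s (j + 1) * (P.s (j + 1 + 1) * z))) = z := by
    rw [← mul_assoc (P.s (j + 1)), b1, one_mul, ← mul_assoc, c1, one_mul]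
  simp only [mul_assoc, cancel]

theorem Good.succ : P.Good (j + 1) where
  commute_s := by
    rw [h.sigH_succ_eq hj (by omega)]
    exact (h.commute_shift_s hj (by omega)).mul_left (P.commute_s_tau hj (by omega)).symm
  commute_q := by
    rw [h.sigH_succ_eq hj (by omega)]
    refine Commute.mul_left ?_ (commute_swap ?_ ?_ ?_).symm
    · refine P.commute_shiftSigH hj (by omega) (z' := P.r (j + 1)) ?_ (h.commute_r_succ hj hk)
      have h1 := P.s_q' (j + 1 + 1) j (by omega) hk hj (by omega) (by omega) (by omega)
      have h2 := P.s_q' j (j + 1 + 1) hj (by omega) (by omega) hk (by omega) (by omega)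
      rw [← mul_assoc, ← h2, mul_assoc, P.q_succ_mul_s (j := j + 1) (by omega) hk, ← mul_assoc]
    · exact P.q_p (j + 1 + 1) j (by omega) hk hj (by omega) (by omega) (by omega)
    · exact P.q_comm (j + 1 + 1) j (by omega) hk hj (by omega)
    · have h2 := P.s_q' j (j + 1 + 1) hj (by omega) (by omega) hk (by omega) (by omega)
      have h3 := P.q_comm (j + 1 + 1) (j + 1) (by omega) hk (by omega) (by omega)
      rw [P.r_eq hj (by omega)]
      exact (Commute.mul_right h2.symm h3).mul_right h2.symm
  q_L_r := by
    have hL := h.r_L_u hj hk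
    have ss := P.s_sq j hj (by omega)
    have Xs := P.q_succ_mul_s hj (by omega)
    have sY := P.s_mul_r_succ hj hk
    have su := P.s_mul_u hj hk
    have sp := (P.p_succ_mul_s hj (by omega)).symm
    have rX := P.r_mul_q_succ hj (by omega)
    have qX : P.q j * P.q (j + 1) = P.r j * P.q (j + 1) := rX.symm
    have Xq : P.q (j + 1) * P.q j = P.q j * P.r j := by
      rw [P.q_mul_r hj (by omega), P.q_comm j (j + 1) hj (by omega) (by omega) (by omega)]
    have qr : P.q j * P.r j = P.r j * P.q (j + 1) := by rw [P.q_mul_r hj (by omega), rX]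
    have qY := (P.u_mul_q hj hk).symm
    have uY : P.u j * P.r (j + 1) = P.r (j + 1) * P.q j := by
      rw [P.u_mul_r_succ hj hk, P.r_succ_mul_q hj hk]
    have uq : P.r (j + 1) * P.q j = P.u j * P.q j := by
      rw [P.r_succ_mul_q hj hk, P.u_mul_q hj hk]
    have uX := P.u_mul_q_succ hj hk
    have up := P.u_mul_p_succ hj hk
    have pX := (P.q_p (j + 1) j (by omega) (by omega) hj (by omega) (by omega) (by omega)).symm
    have pY := P.p_mul_r_succ hj hk
    have Ds := (P.commute_shiftSigHTwo_s hj hk).eq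
    have Dq := (P.commute_shiftSigHTwo_q hj hk).eq
    have e1 := term_one Xs su sp (P.s_q j hj (by omega)) qY uY uX up Ds hL
    have e2 := term_two sY Xs su sp ss (P.q_s j hj (by omega)) Xq qX Dq hL
    have e3 := term_three Xq qY qr (uY.trans uq) uX up pX Dq hL
    have e4 := term_four Xs sY su sp ss Ds hL
    have e5 := term_five Xs su ss (P.s_pp j hj (by omega)) (P.r_mul_r_succ hj hk)
      (P.commute_r_p_succ hj (by omega)).eq pY pX
      (by rw [rX, P.q_succ_mul_r hj (by omega)]) (P.r_p_r hj (by omega))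
      (P.r_p_r (j := j + 1) (by omega) hk) Ds (h.commute_r_succ hj hk).eq (h.r_r_sigH hj hk)
    rw [h.shiftSigH_succ_eq hj hk, P.L_succ j hj (by omega), swap]
    simp only [mul_add, add_mul, mul_sub, sub_mul, mul_neg, neg_mul, e1, e2, e3, e4, e5, mul_one]
    simp only [mul_assoc]
    abel

end GoodStep

theorem good {j : ℕ} (hj : 1 ≤ j) (hk : j + 1 ≤ k - 1) : P.Good j := by
  induction j, hj using Nat.le_induction with
  | base =>
    refine ⟨?_, ?_, ?_⟩
    · rw [sigH_one]; exact Commute.one_left _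
    · rw [sigH_one]; exact Commute.one_left _
    · rw [L_one, shiftSigH_eq, sigH_one, mul_one, P.s_mul_s_inv le_rfl (by omega) (by omega) hk,
        one_mul]
  | succ j hj ih => exact (ih (by omega)).succ hj hk

section Main

variable {j : ℕ}

theorem commute_sigH_succ_p (hj : 1 ≤ j) (hk : j + 1 ≤ k - 1) :
    Commute (P.sigH (j + 1)) (P.p j) := by
  rw [(P.good hj hk).sigH_succ_eq hj hk]
  have h1 := P.pqp₂ j hj (by omega)
  have h2 := P.p_r_p hj hk
  refine (P.commute_shiftSigH_p hj hk).mul_left ?_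
  rw [Commute, SemiconjBy, tau, swap_mul_self_left h1 h2, swap_mul_self_right h1 h2]

variable (hj : 1 ≤ j) (hk : j + 1 + 1 ≤ k - 1)
include hj hk

theorem sigH_succ_succ_eq : P.sigH (j + 1 + 1) =
    P.shiftSigHTwo j * (swap (P.p j) (P.r j) (P.u j) * P.tau (j + 1)) := by
  rw [(P.good (by omega) hk).sigH_succ_eq (by omega) hk,
    (P.good hj (by omega)).shiftSigH_succ_eq hj hk, mul_assoc]

theorem commute_p_swap_tau : Commute (P.p j) (swap (P.p j) (P.r j) (P.u j) * P.tau (j + 1)) := by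
  have h1 := P.p_r_p hj (by omega)
  have h2 := P.p_u_p hj hk
  refine Commute.mul_right ?_ (commute_swap ?_ ?_ ?_)
  · rw [Commute, SemiconjBy, swap_mul_self_left h1 h2, swap_mul_self_right h1 h2]
  · exact P.p_comm j (j + 1) hj (by omega) (by omega) (by omega)
  · exact (P.q_p (j + 1) j (by omega) (by omega) hj (by omega) (by omega) (by omega)).symm
  · exact P.p_mul_r_succ hj hk

theorem commute_swap_tau : Commute (swap (P.p j) (P.r j) (P.u j)) (P.tau (j + 1)) := by
  have hrX : Commute (P.r j) (P.q (j + 1)) := by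
    rw [Commute, SemiconjBy, P.r_mul_q_succ hj (by omega), P.q_succ_mul_r hj (by omega)]
  have huY : Commute (P.u j) (P.r (j + 1)) := by
    rw [Commute, SemiconjBy, P.u_mul_r_succ hj hk, P.r_succ_mul_u hj hk]
  refine commute_swap (commute_swap ?_ ?_ ?_).symm (commute_swap ?_ ?_ ?_).symm
    (commute_swap ?_ ?_ ?_).symm
  · exact P.p_comm (j + 1) j (by omega) (by omega) hj (by omega)
  · exact (P.commute_r_p_succ hj (by omega)).symm
  · exact (P.u_mul_p_succ hj hk).symm
  · exact P.q_p (j + 1) j (by omega) (by omega) hj (by omega) (by omega) (by omega)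
  · exact hrX.symm
  · exact (P.u_mul_q_succ hj hk).symm
  · exact (P.p_mul_r_succ hj hk).symm
  · exact (P.r_mul_r_succ hj hk).symm
  · exact huY.symm

theorem commute_s_swap_tau : Commute (P.s j) (swap (P.p j) (P.r j) (P.u j) * P.tau (j + 1)) := by
  have ss := P.s_sq j hj (by omega)
  have hs := mul_swap_mul (p := P.p j) (x := P.r j) (y := P.u j) ss ss
  rw [P.sps j hj (by omega), ← P.q_succ_mul_s hj (by omega), P.s_mul_u hj hk,
    mul_assoc (P.q (j + 1)), ss, mul_one, mul_assoc (P.r (j + 1)), ss, mul_one, ← tau] at hs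
  have hT := (P.commute_swap_tau hj hk).eq
  generalize swap (P.p j) (P.r j) (P.u j) = T at hs hT ⊢
  have e1 : P.s j * T = P.tau (j + 1) * P.s j := by rw [← hs, mul_assoc, ss, mul_one]
  have e2 : T * P.s j = P.s j * P.tau (j + 1) := by
    rw [← hs, ← mul_assoc, ← mul_assoc, ss, one_mul]
  rw [Commute, SemiconjBy, ← mul_assoc, e1, mul_assoc, ← e2, ← mul_assoc, hT]

theorem commute_q_swap_tau : Commute (P.q j) (swap (P.p j) (P.r j) (P.u j) * P.tau (j + 1)) := by
  have hj' : 1 ≤ j + 1 := by omega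
  have hjk : j + 1 ≤ k - 1 := by omega
  refine commute_swap_mul_swap (P.q_sq (j + 1) hj' hjk) (P.r_sq hj' hk) ?_
    (P.qpq₁ (j + 1) hj' hjk) (P.r_p_r hj' hk) (P.p_comm j (j + 1) hj (by omega) hj' (by omega))
    (P.q_p (j + 1) j hj' hjk hj (by omega) (by omega) (by omega)).symm (P.p_mul_r_succ hj hk)
    (P.commute_r_p_succ hj hjk) ?_ (P.r_mul_r_succ hj hk) (P.u_mul_p_succ hj hk)
    (P.u_mul_q_succ hj hk) ?_ ?_ ?_ (P.q_comm j (j + 1) hj (by omega) hj' hjk)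
    (P.r_succ_mul_q hj hk).symm (P.q_mul_r hj hjk) (P.q_mul_u hj hk) ?_ ?_
  · rw [Commute, SemiconjBy, P.q_mul_r hj' hk, P.r_mul_q hj' hk]
  · rw [Commute, SemiconjBy, P.r_mul_q_succ hj hjk, P.q_succ_mul_r hj hjk]
  · rw [Commute, SemiconjBy, P.u_mul_r_succ hj hk, P.r_succ_mul_u hj hk]
  · rw [Commute, SemiconjBy, P.q_mul_r hj hjk, P.r_mul_q hj hjk]
  · rw [Commute, SemiconjBy, P.q_mul_u hj hk, P.u_mul_q hj hk]
  · rw [P.q_mul_r hj hjk, P.r_mul_q_succ hj hjk]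
  · rw [P.q_mul_u hj hk, P.u_mul_r_succ hj hk]

end Main

end PartitionAlgebra

/-- Theorem 3.6(6)–(9): `σ_{i+1/2}` commutes with `p_{i-1}` for `2 ≤ i ≤ k-1`, and with
`p_{i-3/2}`, `s_{i-2}`, `p_{i-2}` for `3 ≤ i ≤ k-1`. -/
theorem partitionAlgebra_sigH_comm {k : ℕ} {A : Type*} [Ring A]
    [Algebra (Polynomial ℤ) A] (P : PartitionAlgebra k A) :
    (∀ i, 2 ≤ i → i ≤ k - 1 →
      P.sigH i * P.p (i - 1) = P.p (i - 1) * P.sigH i) ∧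
    (∀ i, 3 ≤ i → i ≤ k - 1 →
      P.sigH i * P.q (i - 2) = P.q (i - 2) * P.sigH i ∧
      P.sigH i * P.s (i - 2) = P.s (i - 2) * P.sigH i ∧
      P.sigH i * P.p (i - 2) = P.p (i - 2) * P.sigH i) := by
  refine ⟨fun i hi hik => ?_, fun i hi hik => ?_⟩
  · obtain ⟨j, rfl⟩ : ∃ j, i = j + 1 := ⟨i - 1, by omega⟩
    exact (P.commute_sigH_succ_p (by omega) hik).eq
  · obtain ⟨j, rfl⟩ : ∃ j, i = j + 1 + 1 := ⟨i - 2, by omega⟩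
    have hj : 1 ≤ j := by omega
    rw [show j + 1 + 1 - 2 = j by omega, P.sigH_succ_succ_eq hj hik]
    exact ⟨(P.commute_shiftSigHTwo_q hj hik).mul_left (P.commute_q_swap_tau hj hik).symm,
      (P.commute_shiftSigHTwo_s hj hik).mul_left (P.commute_s_swap_tau hj hik).symm,
      (P.commute_shiftSigHTwo_p hj hik).mul_left (P.commute_p_swap_tau hj hik).symm⟩
end
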